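/- For every closed path polyomino P, there exists a subset Y ⊆ V(P) such that the set G of all inner 2-minors of P is the reduced Gröbner basis of the polyomino ideal I_P with respect to the monomial order <^Y_lex; in particular, the initial ideal of I_P with respect to <^Y_lex is generated by squarefree monomials. -/

import Mathlib

namespace ClosedPathPaper

open MvPolynomial

/-- Lattice points of `ℤ²`; a cell is identified with its lower left corner. -/
abbrev Pt : Type := ℤ × ℤ

/-- The four vertices (corners) of the unit cell with lower left corner `a`. -/
def cellVerts (a : Pt) : Set Pt :=
  {a, (a.1 + 1, a.2), (a.1, a.2 + 1), (a.1 + 1, a.2 + 1)}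

/-- The vertex set `V(P)` of a collection of cells `P`. -/
def VP (P : Finset Pt) : Set Pt := ⋃ a ∈ P, cellVerts a

/-- `[a,b]` is a proper interval and every cell contained in it belongs to `P`. -/
def IsInnerInterval (P : Finset Pt) (a b : Pt) : Prop :=
  a.1 < b.1 ∧ a.2 < b.2 ∧
    ∀ c : Pt, a.1 ≤ c.1 → c.1 < b.1 → a.2 ≤ c.2 → c.2 < b.2 → c ∈ P

/-- The four corners of the proper interval `[a,b]`:
diagonal corners `a, b` and anti-diagonal corners `c = (a.1, b.2)`, `d = (b.1, a.2)`. -/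
def cornersOf (a b : Pt) : Finset Pt := {a, b, (a.1, b.2), (b.1, a.2)}

/-- The inner 2-minor `f_{a,b} = x_a x_b - x_c x_d` attached to the inner interval `[a,b]`. -/
noncomputable def innerMinor (K : Type*) [Field K] (a b : Pt) : MvPolynomial Pt K :=
  X a * X b - X (a.1, b.2) * X (b.1, a.2)

/-- The set `G` of all inner 2-minors of `P`. -/
def minorsSet (K : Type*) [Field K] (P : Finset Pt) : Set (MvPolynomial Pt K) :=
  {f | ∃ a b : Pt, IsInnerInterval P a b ∧ f = innerMinor K a b}

/-- The polyomino ideal `I_P`. -/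
noncomputable def polyoIdeal (K : Type*) [Field K] (P : Finset Pt) :
    Ideal (MvPolynomial Pt K) :=
  Ideal.span (minorsSet K P)

/-! ### Monomial orders -/

/-- Strict lexicographic comparison of exponent vectors induced by the
(strict total) order `po` on the variables. -/
def lexLt (po : Pt → Pt → Prop) (u v : Pt →₀ ℕ) : Prop :=
  ∃ w : Pt, u w < v w ∧ ∀ w' : Pt, po w w' → u w' = v w'

def lexLe (po : Pt → Pt → Prop) (u v : Pt →₀ ℕ) : Prop := u = v ∨ lexLt po u v

/-- `m` is the leading monomial of `f` with respect to the lexicographic order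
induced by `po`. -/
def IsLM {K : Type*} [Field K] (po : Pt → Pt → Prop) (f : MvPolynomial Pt K)
    (m : Pt →₀ ℕ) : Prop :=
  m ∈ f.support ∧ ∀ m' ∈ f.support, lexLe po m' m

/-- `sp` is the S-polynomial of `f` and `g` with respect to the lexicographic
order induced by `po`. -/
def IsSPoly {K : Type*} [Field K] (po : Pt → Pt → Prop) (f g sp : MvPolynomial Pt K) : Prop :=
  ∃ mf mg : Pt →₀ ℕ, IsLM po f mf ∧ IsLM po g mg ∧
    sp = monomial (mf ⊔ mg - mf) (f.coeff mf)⁻¹ * f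
       - monomial (mf ⊔ mg - mg) (g.coeff mg)⁻¹ * g

/-- `h` has a standard expression with respect to `G`, i.e. `h` reduces to `0`
modulo `G` with respect to the lexicographic order induced by `po`. -/
def ReducesToZero {K : Type*} [Field K] (po : Pt → Pt → Prop)
    (G : Set (MvPolynomial Pt K)) (h : MvPolynomial Pt K) : Prop :=
  ∃ (F : Finset (MvPolynomial Pt K)) (q : MvPolynomial Pt K → MvPolynomial Pt K),
    ↑F ⊆ G ∧ h = ∑ g ∈ F, q g * g ∧
    ∀ g ∈ F, ∀ m, IsLM po (q g * g) m → ∃ mh, IsLM po h mh ∧ lexLe po m mh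

/-- The exponent vector of `x_u x_v x_w`. -/
noncomputable def mono3 (u v w : Pt) : Pt →₀ ℕ :=
  Finsupp.single u 1 + Finsupp.single v 1 + Finsupp.single w 1

/-- The leading monomials, viewed as polynomials, of the members of `G`. -/
def leadingMonomials {K : Type*} [Field K] (po : Pt → Pt → Prop)
    (G : Set (MvPolynomial Pt K)) : Set (MvPolynomial Pt K) :=
  {f | ∃ g ∈ G, ∃ m, IsLM po g m ∧ f = monomial m (1 : K)}

/-- The initial ideal of `I` with respect to the lexicographic order induced by `po`. -/
noncomputable def initialIdeal {K : Type*} [Field K] (po : Pt → Pt → Prop)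
    (I : Ideal (MvPolynomial Pt K)) : Ideal (MvPolynomial Pt K) :=
  Ideal.span (leadingMonomials po (I : Set (MvPolynomial Pt K)))

/-- `G` is a Gröbner basis of `I`. -/
def IsGroebnerBasis {K : Type*} [Field K] (po : Pt → Pt → Prop)
    (G : Set (MvPolynomial Pt K)) (I : Ideal (MvPolynomial Pt K)) : Prop :=
  Ideal.span G = I ∧ Ideal.span (leadingMonomials po G) = initialIdeal po I

/-- `G` is the reduced Gröbner basis of `I` (up to normalizing signs). -/
def IsReducedGroebnerBasis {K : Type*} [Field K] (po : Pt → Pt → Prop)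
    (G : Set (MvPolynomial Pt K)) (I : Ideal (MvPolynomial Pt K)) : Prop :=
  IsGroebnerBasis po G I ∧
  (∀ g ∈ G, ∃ m, IsLM po g m ∧ (g.coeff m = 1 ∨ g.coeff m = -1)) ∧
  (∀ g ∈ G, ∀ g' ∈ G, g' ≠ g → ∀ m ∈ g.support, ∀ m', IsLM po g' m' → ¬ m' ≤ m)

/-! ### Closed paths and special configurations -/

/-- Two cells share a common edge. -/
def cellAdj (a b : Pt) : Prop :=
  b = (a.1 + 1, a.2) ∨ b = (a.1 - 1, a.2) ∨ b = (a.1, a.2 + 1) ∨ b = (a.1, a.2 - 1)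

/-- `P` is a closed path polyomino. -/
def IsClosedPath (P : Finset Pt) : Prop :=
  ∃ n : ℕ, 5 < n ∧ ∃ A : ZMod n → Pt,
    Function.Injective A ∧
    (∀ i, cellAdj (A i) (A (i + 1))) ∧
    (∀ i j : ZMod n, j ≠ i - 2 → j ≠ i - 1 → j ≠ i → j ≠ i + 1 → j ≠ i + 2 →
      cellVerts (A i) ∩ cellVerts (A j) = ∅) ∧
    ∀ c : Pt, c ∈ P ↔ ∃ i, A i = c

/-- The horizontal block of rank `m` whose leftmost cell is `a`. -/
def hBlockCells (a : Pt) (m : ℕ) : Finset Pt :=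
  (Finset.range m).image fun t : ℕ => (a.1 + (t : ℤ), a.2)

/-- The vertical block of rank `m` whose bottom cell is `a`. -/
def vBlockCells (a : Pt) (m : ℕ) : Finset Pt :=
  (Finset.range m).image fun t : ℕ => (a.1, a.2 + (t : ℤ))

/-- The vertex set of a finite set of cells. -/
def vertsOfCells (s : Finset Pt) : Set Pt := ⋃ c ∈ s, cellVerts c

/-- A W-pentomino of `P`: a horizontal block of rank two with leftmost cell `a₁`, a
vertical block of rank two with bottom cell `a₂`, and a middle cell `A` not belonging to the
two blocks, such that the vertex sets of the two blocks meet exactly in the lower right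
corner of `A`. -/
def IsWPentomino (P : Finset Pt) (a₁ a₂ A : Pt) : Prop :=
  hBlockCells a₁ 2 ⊆ P ∧ vBlockCells a₂ 2 ⊆ P ∧ A ∈ P ∧
  A ∉ hBlockCells a₁ 2 ∪ vBlockCells a₂ 2 ∧
  vertsOfCells (hBlockCells a₁ 2) ∩ vertsOfCells (vBlockCells a₂ 2) = {(A.1 + 1, A.2)}

/-- An RW-heptomino of `P`: a horizontal block of rank three with leftmost cell `a₁`, a
vertical block of rank three with bottom cell `a₂`, and a middle cell `A` not belonging to
the two blocks, such that the vertex sets of the two blocks meet exactly in the upper left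
corner of `A`. -/
def IsRWHeptomino (P : Finset Pt) (a₁ a₂ A : Pt) : Prop :=
  hBlockCells a₁ 3 ⊆ P ∧ vBlockCells a₂ 3 ⊆ P ∧ A ∈ P ∧
  A ∉ hBlockCells a₁ 3 ∪ vBlockCells a₂ 3 ∧
  vertsOfCells (hBlockCells a₁ 3) ∩ vertsOfCells (vBlockCells a₂ 3) = {(A.1, A.2 + 1)}

/-- An LD-horizontal skew tetromino of `P` (base point `p`): the cells
`p, p+(1,0), p+(1,1), p+(2,1)`. -/
def IsLDhTetromino (P : Finset Pt) (p : Pt) : Prop :=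
  p ∈ P ∧ (p.1 + 1, p.2) ∈ P ∧ (p.1 + 1, p.2 + 1) ∈ P ∧ (p.1 + 2, p.2 + 1) ∈ P

/-- An LD-vertical skew tetromino of `P` (base point `p`): the cells
`p, p+(0,1), p+(1,1), p+(1,2)`. -/
def IsLDvTetromino (P : Finset Pt) (p : Pt) : Prop :=
  p ∈ P ∧ (p.1, p.2 + 1) ∈ P ∧ (p.1 + 1, p.2 + 1) ∈ P ∧ (p.1 + 1, p.2 + 2) ∈ P

/-- An LD-horizontal skew hexomino of `P` (base point `p`): the cells
`p, p+(1,0), p+(2,0), p+(2,1), p+(3,1), p+(4,1)`. -/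
def IsLDhHexomino (P : Finset Pt) (p : Pt) : Prop :=
  p ∈ P ∧ (p.1 + 1, p.2) ∈ P ∧ (p.1 + 2, p.2) ∈ P ∧
  (p.1 + 2, p.2 + 1) ∈ P ∧ (p.1 + 3, p.2 + 1) ∈ P ∧ (p.1 + 4, p.2 + 1) ∈ P

/-- An LD-vertical skew hexomino of `P` (base point `p`): the cells
`p, p+(0,1), p+(0,2), p+(1,2), p+(1,3), p+(1,4)`. -/
def IsLDvHexomino (P : Finset Pt) (p : Pt) : Prop :=
  p ∈ P ∧ (p.1, p.2 + 1) ∈ P ∧ (p.1, p.2 + 2) ∈ P ∧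
  (p.1 + 1, p.2 + 2) ∈ P ∧ (p.1 + 1, p.2 + 3) ∈ P ∧ (p.1 + 1, p.2 + 4) ∈ P

/-- The total order `<¹` on `ℤ²`. -/
def lt1 (a b : Pt) : Prop := a.1 < b.1 ∨ (a.1 = b.1 ∧ a.2 < b.2)

/-- The P-order `<^Y` attached to a set `Y` of vertices. -/
def Ylt (Y : Set Pt) (a b : Pt) : Prop :=
  (a ∉ Y ∧ b ∈ Y) ∨ (a ∉ Y ∧ b ∉ Y ∧ lt1 a b) ∨ (a ∈ Y ∧ b ∈ Y ∧ lt1 a b)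



/-! ### Orders -/

theorem Ylt_irrefl (Y : Set Pt) (a : Pt) : ¬ Ylt Y a a := by
  unfold Ylt lt1; intro h; rcases h with h | h | h
  · exact h.1 h.2
  · have := h.2.2; omega
  · have := h.2.2; omega

theorem Ylt_trans (Y : Set Pt) {a b c : Pt} (h : Ylt Y a b) (h' : Ylt Y b c) : Ylt Y a c := by
  unfold Ylt lt1 at *
  by_cases ha : a ∈ Y <;> by_cases hb : b ∈ Y <;> by_cases hc : c ∈ Y <;> simp_all <;> omega

theorem Ylt_total (Y : Set Pt) (a b : Pt) : Ylt Y a b ∨ a = b ∨ Ylt Y b a := by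
  unfold Ylt lt1
  obtain ⟨a1, a2⟩ := a
  obtain ⟨b1, b2⟩ := b
  by_cases ha : ((a1, a2) : Pt) ∈ Y <;> by_cases hb : ((b1, b2) : Pt) ∈ Y <;> simp_all <;> omega

theorem lexLt_irrefl (po : Pt → Pt → Prop) (u : Pt →₀ ℕ) : ¬ lexLt po u u := by
  rintro ⟨w, h, -⟩; omega

theorem lexLt_trans (Y : Set Pt) {u v w : Pt →₀ ℕ} (h : lexLt (Ylt Y) u v)
    (h' : lexLt (Ylt Y) v w) : lexLt (Ylt Y) u w := by
  obtain ⟨a, ha, ha'⟩ := h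
  obtain ⟨b, hb, hb'⟩ := h'
  rcases Ylt_total Y a b with hab | rfl | hab
  · exact ⟨b, by rw [ha' b hab]; exact hb, fun c hc => by
      rw [ha' c (Ylt_trans Y hab hc), hb' c hc]⟩
  · exact ⟨a, by omega, fun c hc => by rw [ha' c hc, hb' c hc]⟩
  · exact ⟨a, by rw [← hb' a hab]; exact ha, fun c hc => by
      rw [ha' c hc, hb' c (Ylt_trans Y hab hc)]⟩

theorem lexLt_add (po : Pt → Pt → Prop) {u v : Pt →₀ ℕ} (w : Pt →₀ ℕ) (h : lexLt po u v) :
    lexLt po (w + u) (w + v) := by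
  obtain ⟨a, ha, ha'⟩ := h
  exact ⟨a, by simpa using ha, fun c hc => by simp [ha' c hc]⟩

/-- unit exponent -/
noncomputable def ee (x y : ℤ) : Pt →₀ ℕ := Finsupp.single (x, y) 1

/-- one reduction step for a family `L` of leading pairs -/
def Step (L : ℤ → ℤ → ℤ → ℤ → Prop) (α β : Pt →₀ ℕ) : Prop :=
  ∃ (x y x' y' : ℤ) (u : Pt →₀ ℕ), L x y x' y' ∧ α = u + (ee x y + ee x' y') ∧
    β = u + (ee x y' + ee x' y)

open Relation

theorem newman {α : Type*} (r : α → α → Prop) (wf : WellFounded (Function.swap r))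
    (loc : ∀ a b c, r a b → r a c → Join (ReflTransGen r) b c) :
    ∀ a b c, ReflTransGen r a b → ReflTransGen r a c → Join (ReflTransGen r) b c := by
  intro a
  induction a using wf.induction with
  | _ a ih =>
    intro b c hb hc
    rcases ReflTransGen.cases_head hb with rfl | ⟨b', hab, hbb⟩
    · exact ⟨c, hc, .refl⟩
    rcases ReflTransGen.cases_head hc with rfl | ⟨c', hac, hcc⟩
    · exact ⟨b, .refl, hb⟩
    obtain ⟨d, hd1, hd2⟩ := loc a b' c' hab hac
    obtain ⟨e, he1, he2⟩ := ih b' hab b d hbb hd1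
    obtain ⟨f, hf1, hf2⟩ := ih c' hac e c (hd2.trans he2) hcc
    exact ⟨f, he1.trans hf1, hf2⟩

theorem exists_normal {α : Type*} (r : α → α → Prop) (wf : WellFounded (Function.swap r)) :
    ∀ a, ∃ b, ReflTransGen r a b ∧ ∀ c, ¬ r b c := by
  intro a
  induction a using wf.induction with
  | _ a ih =>
    by_cases h : ∃ c, r a c
    · obtain ⟨c, hc⟩ := h
      obtain ⟨b, hb, hb'⟩ := ih c hc
      exact ⟨b, .head hc hb, hb'⟩
    · exact ⟨a, .refl, fun c hc => h ⟨c, hc⟩⟩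

/-- Abstract data used for the Groebner argument. -/
structure GData (P : Finset Pt) (Y : Set Pt) (L : ℤ → ℤ → ℤ → ℤ → Prop) : Prop where
  sym : ∀ x y x' y', L x y x' y' → L x' y' x y
  inV : ∀ x y x' y', L x y x' y' → (x, y) ∈ VP P
  ne : ∀ x y x' y', L x y x' y' → x ≠ x' ∧ y ≠ y'
  dich : ∀ a b, IsInnerInterval P a b → L a.1 a.2 b.1 b.2 ∨ L a.1 b.2 b.1 a.2
  inner : ∀ x y x' y', L x y x' y' →
    IsInnerInterval P (min x x', min y y') (max x x', max y y')
  lead : ∀ x y x' y', L x y x' y' → lexLt (Ylt Y) (ee x y' + ee x' y) (ee x y + ee x' y')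
  loc : ∀ x y x' y' x'' y'', L x y x' y' → L x y x'' y'' → (x', y') ≠ (x'', y'') → ∀ u,
    Join (ReflTransGen (Step L)) (u + ee x'' y'' + (ee x y' + ee x' y))
      (u + ee x' y' + (ee x y'' + ee x'' y))

theorem VP_finite (P : Finset Pt) : (VP P).Finite := by
  unfold VP cellVerts
  exact Set.Finite.biUnion P.finite_toSet (fun _ _ => by simp)

section
variable {P : Finset Pt} {Y : Set Pt} {L : ℤ → ℤ → ℤ → ℤ → Prop}

theorem GData.step_lt (D : GData P Y L) {α β : Pt →₀ ℕ} (h : Step L α β) :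
    lexLt (Ylt Y) β α := by
  obtain ⟨x, y, x', y', u, h, rfl, rfl⟩ := h
  exact lexLt_add _ _ (D.lead _ _ _ _ h)

theorem GData.steps_le (D : GData P Y L) {α β : Pt →₀ ℕ} (h : ReflTransGen (Step L) α β) :
    lexLe (Ylt Y) β α := by
  induction h with
  | refl => exact Or.inl rfl
  | tail _ h ih =>
    have := D.step_lt h
    rcases ih with rfl | ih
    · exact Or.inr this
    · exact Or.inr (lexLt_trans _ this ih)

theorem GData.step_lt' (D : GData P Y L) {α β : Pt →₀ ℕ} (h : Step L α β) :
    ∃ w ∈ VP P, β w < α w ∧ ∀ w', Ylt Y w w' → β w' = α w' := by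
  obtain ⟨w, h1, h2⟩ := D.step_lt h
  refine ⟨w, ?_, h1, h2⟩
  obtain ⟨x, y, x', y', u, h, rfl, rfl⟩ := h
  by_cases e1 : (x, y) = w
  · exact e1 ▸ D.inV _ _ _ _ h
  by_cases e2 : (x', y') = w
  · exact e2 ▸ D.inV _ _ _ _ (D.sym _ _ _ _ h)
  simp [ee, Finsupp.single_apply, e1, e2] at h1

theorem GData.wf (D : GData P Y L) : WellFounded (Function.swap (Step L)) := by
  have : Finite (VP P) := (VP_finite P).to_subtype
  let r : VP P → VP P → Prop := fun a b => Ylt Y b a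
  have hr : IsStrictTotalOrder (VP P) r :=
    { irrefl := fun a => Ylt_irrefl Y a
      trans := fun a b c h h' => Ylt_trans Y h' h
      trichotomous := fun a b h1 h2 => by
        rcases Ylt_total Y a b with h | h | h
        · exact absurd h h2
        · exact Subtype.ext h
        · exact absurd h h1 }
  have W := Pi.Lex.wellFounded (α := fun _ : VP P => ℕ) r (s := fun _ a b => a < b)
    (fun _ => wellFounded_lt)
  refine Subrelation.wf (r := InvImage _ fun (α : Pt →₀ ℕ) (v : VP P) => α v) ?_ (InvImage.wf _ W)
  intro β α h
  obtain ⟨w, hw, h1, h2⟩ := D.step_lt' h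
  exact ⟨⟨w, hw⟩, fun j hj => h2 j hj, h1⟩

theorem GData.local (D : GData P Y L) : ∀ a b c, Step L a b → Step L a c →
    Join (ReflTransGen (Step L)) b c := by
  have shared : ∀ x y x' y' x'' y'' u u', L x y x' y' → L x y x'' y'' →
      u + (ee x y + ee x' y') = u' + (ee x y + ee x'' y'') →
      Join (ReflTransGen (Step L)) (u + (ee x y' + ee x' y)) (u' + (ee x y'' + ee x'' y)) := by
    intro x y x' y' x'' y'' u u' h h' he
    by_cases hp : (x', y') = (x'', y'')
    · obtain ⟨rfl, rfl⟩ := Prod.mk.inj hp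
      have : u = u' := by simpa using he
      subst this
      exact ⟨_, .refl, .refl⟩
    · have e1 : ee x'' y'' ≤ u := by
        intro z
        have := DFunLike.congr_fun he z
        simp only [ee, Finsupp.single_apply, Finsupp.add_apply] at this ⊢
        grind
      obtain ⟨w, rfl⟩ := exists_add_of_le e1
      have e2 : u' = w + ee x' y' := by
        ext z
        have := DFunLike.congr_fun he z
        simp only [Finsupp.add_apply] at this ⊢
        omega
      subst e2
      have := D.loc x y x' y' x'' y'' h h' hp w
      rwa [add_comm w] at this
  rintro a b c ⟨x1, y1, x1', y1', u1, h1, rfl, rfl⟩ ⟨x2, y2, x2', y2', u2, h2, he, rfl⟩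
  by_cases c1 : (x1, y1) = (x2, y2)
  · obtain ⟨rfl, rfl⟩ := Prod.mk.inj c1
    exact shared _ _ _ _ _ _ _ _ h1 h2 he
  by_cases c2 : (x1, y1) = (x2', y2')
  · obtain ⟨rfl, rfl⟩ := Prod.mk.inj c2
    rw [add_comm (ee x2 y1)]
    exact shared _ _ _ _ _ _ _ _ h1 (D.sym _ _ _ _ h2) (by rw [he, add_comm (ee x2 y2)])
  by_cases c3 : (x1', y1') = (x2, y2)
  · obtain ⟨rfl, rfl⟩ := Prod.mk.inj c3
    rw [add_comm (ee x1 y1')]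
    exact shared _ _ _ _ _ _ _ _ (D.sym _ _ _ _ h1) h2 (by rw [← he, add_comm (ee x1 y1)])
  by_cases c4 : (x1', y1') = (x2', y2')
  · obtain ⟨rfl, rfl⟩ := Prod.mk.inj c4
    rw [add_comm (ee x1 y1'), add_comm (ee x2 y1')]
    exact shared _ _ _ _ _ _ _ _ (D.sym _ _ _ _ h1) (D.sym _ _ _ _ h2)
      (by rw [add_comm (ee x1' y1'), he, add_comm (ee x2 y2)])
  have e1 : ee x2 y2 + ee x2' y2' ≤ u1 := by
    intro z
    have := DFunLike.congr_fun he z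
    simp only [ee, Finsupp.single_apply, Finsupp.add_apply] at this ⊢
    grind
  obtain ⟨w, rfl⟩ := exists_add_of_le e1
  have e2 : u2 = w + (ee x1 y1 + ee x1' y1') := by
    ext z
    have := DFunLike.congr_fun he z
    simp only [Finsupp.add_apply] at this ⊢
    omega
  subst e2
  refine ⟨w + (ee x1 y1' + ee x1' y1) + (ee x2 y2' + ee x2' y2), .single ?_, .single ?_⟩
  · exact ⟨x2, y2, x2', y2', w + (ee x1 y1' + ee x1' y1), h2, by abel, by abel⟩
  · exact ⟨x1, y1, x1', y1', w + (ee x2 y2' + ee x2' y2), h1, by abel, by abel⟩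

/-- Every leading monomial of the ideal is divisible by a leading pair. -/
theorem GData.main (D : GData P Y L) (K : Type*) [Field K] (f : MvPolynomial Pt K)
    (hf : f ∈ polyoIdeal K P) (m : Pt →₀ ℕ) (hm : IsLM (Ylt Y) f m) :
    ∃ x y x' y', L x y x' y' ∧ ee x y + ee x' y' ≤ m := by
  classical
  by_contra hcon
  have hnorm : ∀ c, ¬ Step L m c := by
    rintro c ⟨x, y, x', y', u, h, rfl, -⟩
    exact hcon ⟨x, y, x', y', h, by simp⟩
  have hnf := newman (Step L) D.wf D.local
  choose nf hnf1 hnf2 using exists_normal (Step L) D.wf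
  have huniq : ∀ a b, Step L a b → nf a = nf b := by
    intro a b h
    obtain ⟨d, h1, h2⟩ := hnf a (nf a) (nf b) (hnf1 a) (.head h (hnf1 b))
    have e1 : nf a = d := by
      rcases ReflTransGen.cases_head h1 with h | ⟨c, hc, -⟩
      · exact h
      · exact absurd hc (hnf2 _ _)
    have e2 : nf b = d := by
      rcases ReflTransGen.cases_head h2 with h | ⟨c, hc, -⟩
      · exact h
      · exact absurd hc (hnf2 _ _)
    rw [e1, e2]
  let φ : MvPolynomial Pt K →ₗ[K] K :=
    (MvPolynomial.basisMonomials Pt K).constr K (fun α => if nf α = m then (1 : K) else 0)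
  have hφ : ∀ α (c : K), φ (monomial α c) = if nf α = m then c else 0 := by
    intro α c
    have h1 : φ (monomial α (1 : K)) = if nf α = m then (1 : K) else 0 := by
      have := Module.Basis.constr_basis (MvPolynomial.basisMonomials Pt K) K
        (fun α => if nf α = m then (1 : K) else 0) α
      simpa [φ] using this
    have h2 : (monomial α c : MvPolynomial Pt K) = c • monomial α (1 : K) := by
      simp [MvPolynomial.smul_monomial]
    rw [h2, map_smul, h1]
    split_ifs <;> simp
  have hker : ∀ g ∈ polyoIdeal K P, ∀ h, φ (h * g) = 0 := by
    intro g hg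
    unfold polyoIdeal at hg
    induction hg using Submodule.span_induction with
    | mem g hg =>
      obtain ⟨a, b, hab, rfl⟩ := hg
      intro h
      induction h using MvPolynomial.induction_on' with
      | monomial u c =>
        have e : monomial u c * innerMinor K a b
            = monomial (u + (ee a.1 a.2 + ee b.1 b.2)) c
              - monomial (u + (ee a.1 b.2 + ee b.1 a.2)) c := by
          simp [innerMinor, ee, MvPolynomial.X, mul_sub, MvPolynomial.monomial_mul]
        rw [e, map_sub, hφ, hφ]
        have : nf (u + (ee a.1 a.2 + ee b.1 b.2)) = nf (u + (ee a.1 b.2 + ee b.1 a.2)) := by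
          rcases D.dich a b hab with h | h
          · exact huniq _ _ ⟨_, _, _, _, u, h, rfl, rfl⟩
          · exact (huniq _ _ ⟨_, _, _, _, u, h, rfl, rfl⟩).symm
        rw [this]; simp
      | add p q hp hq => rw [add_mul, map_add, hp, hq, add_zero]
    | zero => simp
    | add x y _ _ hx hy => intro h; rw [mul_add, map_add, hx, hy, add_zero]
    | smul a x _ hx => intro h; rw [smul_eq_mul, ← mul_assoc]; exact hx _
  have h0 : φ f = 0 := by simpa using hker f hf 1
  have h1 : φ f = coeff m f := by
    conv_lhs => rw [MvPolynomial.as_sum f]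
    rw [map_sum]
    rw [Finset.sum_eq_single m]
    · rw [hφ]
      have : nf m = m := by
        rcases ReflTransGen.cases_head (hnf1 m) with h | ⟨c, hc, -⟩
        · exact h.symm
        · exact absurd hc (hnorm _)
      simp [this]
    · intro α hα hne
      rw [hφ, if_neg]
      intro hn
      have h1 := D.steps_le (hnf1 α)
      rw [hn] at h1
      have h2 := hm.2 α hα
      rcases h1 with h1 | h1
      · exact hne h1.symm
      rcases h2 with h2 | h2
      · exact hne h2
      exact lexLt_irrefl _ _ (lexLt_trans _ h1 h2)
    · intro h; exact absurd hm.1 h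
  exact (MvPolynomial.mem_support_iff.mp hm.1) (h1 ▸ h0)

end

section
variable {P : Finset Pt} {Y : Set Pt} {L : ℤ → ℤ → ℤ → ℤ → Prop}

theorem ee_add_inj {x y x' y' u v u' v' : ℤ} (hx : x ≠ x')
    (h : ee x y + ee x' y' = ee u v + ee u' v') :
    ((x, y) = (u, v) ∧ (x', y') = (u', v')) ∨ ((x, y) = (u', v') ∧ (x', y') = (u, v)) := by
  have h1 := DFunLike.congr_fun h (x, y)
  have h2 := DFunLike.congr_fun h (x', y')
  simp only [ee, Finsupp.single_apply, Finsupp.add_apply] at h1 h2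
  grind

theorem ee_add_le {x y x' y' u v u' v' : ℤ} (hx : x ≠ x')
    (h : ee x y + ee x' y' ≤ ee u v + ee u' v') : ee x y + ee x' y' = ee u v + ee u' v' := by
  have h1 := h (x, y)
  have h2 := h (x', y')
  simp only [ee, Finsupp.single_apply, Finsupp.add_apply] at h1 h2
  have : ((x, y) = (u, v) ∧ (x', y') = (u', v')) ∨ ((x, y) = (u', v') ∧ (x', y') = (u, v)) := by
    grind
  rcases this with ⟨h1, h2⟩ | ⟨h1, h2⟩
  · simp only [ee]; rw [h1, h2]
  · simp only [ee]; rw [h1, h2, add_comm]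

theorem coeff_minor (K : Type*) [Field K] (a b : Pt) (m : Pt →₀ ℕ) :
    coeff m (innerMinor K a b) = (if ee a.1 a.2 + ee b.1 b.2 = m then 1 else 0)
      - (if ee a.1 b.2 + ee b.1 a.2 = m then 1 else 0) := by
  classical
  have e : innerMinor K a b
            = monomial ((ee a.1 a.2 + ee b.1 b.2)) 1
              - monomial ((ee a.1 b.2 + ee b.1 a.2)) 1 := by
          simp [innerMinor, ee, MvPolynomial.X, MvPolynomial.monomial_mul]
  rw [e, coeff_sub, coeff_monomial, coeff_monomial]

theorem minor_ne {a b : Pt} (hab : IsInnerInterval P a b) :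
    ee a.1 a.2 + ee b.1 b.2 ≠ ee a.1 b.2 + ee b.1 a.2 := by
  intro h
  have h1 := hab.1
  have h2 := hab.2.1
  have := ee_add_inj (by omega) h
  simp only [Prod.mk.injEq] at this
  omega

theorem supp_minor (K : Type*) [Field K] {a b : Pt} (hab : IsInnerInterval P a b) (m : Pt →₀ ℕ) :
    m ∈ (innerMinor K a b).support ↔
      m = ee a.1 a.2 + ee b.1 b.2 ∨ m = ee a.1 b.2 + ee b.1 a.2 := by
  have := minor_ne hab
  rw [mem_support_iff, coeff_minor]
  split_ifs <;> simp_all [eq_comm]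

theorem GData.lm (D : GData P Y L) (K : Type*) [Field K] {a b : Pt}
    (hab : IsInnerInterval P a b) :
    (L a.1 a.2 b.1 b.2 ∧ IsLM (Ylt Y) (innerMinor K a b) (ee a.1 a.2 + ee b.1 b.2)) ∨
    (L a.1 b.2 b.1 a.2 ∧ IsLM (Ylt Y) (innerMinor K a b) (ee a.1 b.2 + ee b.1 a.2)) := by
  rcases D.dich a b hab with h | h
  · refine Or.inl ⟨h, ?_⟩
    refine ⟨(supp_minor K hab _).2 (Or.inl rfl), fun m hm => ?_⟩
    rcases (supp_minor K hab _).1 hm with rfl | rfl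
    · exact Or.inl rfl
    · exact Or.inr (D.lead _ _ _ _ h)
  · refine Or.inr ⟨h, ?_⟩
    refine ⟨(supp_minor K hab _).2 (Or.inr rfl), fun m hm => ?_⟩
    rcases (supp_minor K hab _).1 hm with rfl | rfl
    · exact Or.inr (D.lead _ _ _ _ h)
    · exact Or.inl rfl

theorem IsLM_unique {K : Type*} [Field K] {f : MvPolynomial Pt K} {m m' : Pt →₀ ℕ}
    (h : IsLM (Ylt Y) f m) (h' : IsLM (Ylt Y) f m') : m = m' := by
  rcases h.2 _ h'.1 with h1 | h1
  · exact h1.symm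
  rcases h'.2 _ h.1 with h2 | h2
  · exact h2
  exact absurd (lexLt_trans _ h1 h2) (lexLt_irrefl _ _)

/-- A leading pair yields an element of `G` with that leading monomial. -/
theorem GData.lm' (D : GData P Y L) (K : Type*) [Field K] {x y x' y' : ℤ}
    (h : L x y x' y') : ∃ g ∈ minorsSet K P, IsLM (Ylt Y) g (ee x y + ee x' y') := by
  have hi := D.inner _ _ _ _ h
  have hne := D.ne _ _ _ _ h
  refine ⟨_, ⟨_, _, hi, rfl⟩, ?_⟩
  have hs : ee x y + ee x' y' ∈
      (innerMinor K (min x x', min y y') (max x x', max y y')).support := by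
    rw [supp_minor K hi]
    rcases lt_or_gt_of_ne hne.1 with h1 | h1 <;> rcases lt_or_gt_of_ne hne.2 with h2 | h2 <;>
      simp [min_eq_left h1.le, max_eq_right h1.le, min_eq_right h1.le, max_eq_left h1.le,
        min_eq_left h2.le, max_eq_right h2.le, min_eq_right h2.le, max_eq_left h2.le, add_comm]
  refine ⟨hs, fun m hm => ?_⟩
  by_cases hmm : m = ee x y + ee x' y'
  · exact Or.inl hmm
  have : m = ee x y' + ee x' y := by
    rw [supp_minor K hi] at hm hs
    rcases lt_or_gt_of_ne hne.1 with h1 | h1 <;> rcases lt_or_gt_of_ne hne.2 with h2 | h2 <;>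
      simp only [min_eq_left h1.le, max_eq_right h1.le, min_eq_right h1.le, max_eq_left h1.le,
        min_eq_left h2.le, max_eq_right h2.le, min_eq_right h2.le, max_eq_left h2.le] at hm <;>
      rcases hm with hm | hm <;> rw [hm] at hmm ⊢ <;> simp_all [add_comm]
  rw [this]
  exact Or.inr (D.lead _ _ _ _ h)

theorem GData.final (D : GData P Y L) (K : Type*) [Field K] :
    IsReducedGroebnerBasis (Ylt Y) (minorsSet K P) (polyoIdeal K P) ∧
      ∃ M : Set (Pt →₀ ℕ), (∀ m ∈ M, ∀ w, m w ≤ 1) ∧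
        initialIdeal (Ylt Y) (polyoIdeal K P) =
          Ideal.span ((fun m => (MvPolynomial.monomial m (1 : K))) '' M) := by
  have key : Ideal.span (leadingMonomials (Ylt Y) (minorsSet K P))
      = initialIdeal (Ylt Y) (polyoIdeal K P) := by
    apply le_antisymm
    · apply Ideal.span_mono
      rintro f ⟨g, hg, m, hm, rfl⟩
      exact ⟨g, Ideal.subset_span hg, m, hm, rfl⟩
    · unfold initialIdeal
      rw [Ideal.span_le]
      rintro f ⟨g, hg, m, hm, rfl⟩
      obtain ⟨x, y, x', y', h, hle⟩ := D.main K g hg m hm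
      obtain ⟨g', hg', hlm⟩ := D.lm' K h
      obtain ⟨u, rfl⟩ := exists_add_of_le hle
      have : (monomial (ee x y + ee x' y' + u) (1 : K)) =
          monomial u 1 * monomial (ee x y + ee x' y') 1 := by
        rw [monomial_mul, add_comm]; simp
      rw [SetLike.mem_coe, this]
      exact Ideal.mul_mem_left _ _ (Ideal.subset_span ⟨g', hg', _, hlm, rfl⟩)
  refine ⟨⟨⟨rfl, key⟩, ?_, ?_⟩, ?_⟩
  · rintro g ⟨a, b, hab, rfl⟩
    have hne := minor_ne hab
    rcases D.lm K hab with ⟨-, h⟩ | ⟨-, h⟩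
    · refine ⟨_, h, Or.inl ?_⟩
      rw [coeff_minor, if_pos rfl, if_neg hne.symm]; simp
    · refine ⟨_, h, Or.inr ?_⟩
      rw [coeff_minor, if_pos rfl, if_neg hne]; simp
  · rintro g ⟨a, b, hab, rfl⟩ g' ⟨a', b', hab', rfl⟩ hne m hm m' hm' hle
    apply hne
    have hs := (supp_minor K hab' _).1 hm'.1
    rw [supp_minor K hab] at hm
    obtain ⟨a1, a2⟩ := a
    obtain ⟨b1, b2⟩ := b
    obtain ⟨a1', a2'⟩ := a'
    obtain ⟨b1', b2'⟩ := b'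
    have h1 := hab.1
    have h2 := hab.2.1
    have h1' := hab'.1
    have h2' := hab'.2.1
    simp only at h1 h2 h1' h2' hm hs
    have : a1 = a1' ∧ a2 = a2' ∧ b1 = b1' ∧ b2 = b2' := by
      rcases hm with rfl | rfl <;> rcases hs with rfl | rfl <;>
        have := ee_add_inj (by omega) (ee_add_le (by omega) hle) <;>
        simp only [Prod.mk.injEq] at this <;> omega
    obtain ⟨rfl, rfl, rfl, rfl⟩ := this
    rfl
  · refine ⟨{m | ∃ g ∈ minorsSet K P, IsLM (Ylt Y) g m}, ?_, ?_⟩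
    · rintro m ⟨g, ⟨a, b, hab, rfl⟩, hm⟩ w
      have h1 := hab.1
      have h2 := hab.2.1
      rcases (supp_minor K hab _).1 hm.1 with rfl | rfl <;>
        simp only [ee, Finsupp.single_apply, Finsupp.add_apply] <;> grind
    · rw [← key]
      congr 1
      ext f
      constructor
      · rintro ⟨g, hg, m, hm, rfl⟩
        exact ⟨m, ⟨g, hg, hm⟩, rfl⟩
      · rintro ⟨m, ⟨g, hg, hm⟩, rfl⟩
        exact ⟨g, hg, m, hm, rfl⟩

end

/-- A sign. -/
def Sg (ε : ℤ) : Prop := ε = 1 ∨ ε = -1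

theorem Sg.neg {ε : ℤ} (h : Sg ε) : Sg (-ε) := by unfold Sg at *; omega

/-- Abstract configuration: `R` = inner rectangles by opposite corners, `L` = leading pairs. -/
structure Cfg (R L : ℤ → ℤ → ℤ → ℤ → Prop) : Prop where
  Rx : ∀ x y x' y', R x y x' y' → R x' y x y'
  Ry : ∀ x y x' y', R x y x' y' → R x y' x' y
  ne : ∀ x y x' y', R x y x' y' → x ≠ x' ∧ y ≠ y'
  splitx : ∀ x y x' y' x'', x < x' → x' < x'' →
    (R x y x'' y' ↔ R x y x' y' ∧ R x' y x'' y')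
  splity : ∀ x y x' y' y'', y < y' → y' < y'' →
    (R x y x' y'' ↔ R x y x' y' ∧ R x y' x' y'')
  no22 : ∀ x y x' y', R x y x' y' → (x' = x + 1 ∨ x' = x - 1) ∨ (y' = y + 1 ∨ y' = y - 1)
  diag : ∀ x y ε δ, Sg ε → Sg δ → R x y (x + ε) (y + δ) → R x y (x - ε) (y - δ) →
    R x y (x + ε) (y - δ) ∨ R x y (x - ε) (y + δ)
  Lsym : ∀ x y x' y', L x y x' y' → L x' y' x y
  LR : ∀ x y x' y', L x y x' y' → R x y x' y'
  dich : ∀ x y x' y', R x y x' y' → (L x y x' y' ↔ ¬ L x y' x' y)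
  soft : ∀ a b ε δ, Sg ε → Sg δ → R a b (a + 2 * ε) (b + δ) → R a b (a + ε) (b + 2 * δ) →
    (∀ c, R (a + ε) b c (b + δ) → R a b c (b + δ) →
        (L a b c (b + δ) ↔ L (a + ε) b c (b + δ))) ∨
    (∀ d, R a (b + δ) (a + ε) d → R a b (a + ε) d →
        (L a b (a + ε) d ↔ L a (b + δ) (a + ε) d))
  hardh : ∀ a b ε δ c i j, Sg ε → Sg δ → R a b (a + ε) (b + δ) →
    0 < δ * c - 1 → 0 < i → 0 < j →
    L a b (a - ε) (b + c) → L a b (a + ε * i) (b - δ * j) → False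
  hardv : ∀ a b ε δ c i j, Sg ε → Sg δ → R a b (a + ε) (b + δ) →
    0 < ε * c - 1 → 0 < i → 0 < j →
    L a b (a + c) (b - δ) → L a b (a - ε * i) (b + δ * j) → False

/-- Joinability certificate for leading pairs `{v,p}`, `{v,s}`. -/
def JJ (R L : ℤ → ℤ → ℤ → ℤ → Prop) (x y x' y' x'' y'' : ℤ) : Prop :=
  (x' = x'' ∧ R x y' x'' y'') ∨ (y' = y'' ∧ R x' y x'' y'') ∨
  (R x y' x'' y'' ∧ R x' y' x'' y ∧ ¬ (L x y'' x'' y' ∧ L x' y x'' y')) ∨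
  (R x' y x'' y'' ∧ R x' y' x y'' ∧ ¬ (L x'' y x' y'' ∧ L x y' x' y''))

section
variable {R L : ℤ → ℤ → ℤ → ℤ → Prop}

theorem Cfg.transp (D : Cfg R L) :
    Cfg (fun x y x' y' => R y x y' x') (fun x y x' y' => L y x y' x') where
  Rx x y x' y' h := D.Ry _ _ _ _ h
  Ry x y x' y' h := D.Rx _ _ _ _ h
  ne x y x' y' h := (D.ne _ _ _ _ h).symm
  splitx x y x' y' x'' h h' := D.splity _ _ _ _ _ h h'
  splity x y x' y' y'' h h' := D.splitx _ _ _ _ _ h h'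
  no22 x y x' y' h := (D.no22 _ _ _ _ h).symm
  diag x y ε δ h h' h1 h2 := (D.diag _ _ _ _ h' h h1 h2).symm
  Lsym x y x' y' h := D.Lsym _ _ _ _ h
  LR x y x' y' h := D.LR _ _ _ _ h
  dich x y x' y' h := by
    rw [D.dich _ _ _ _ h]
    constructor
    · exact fun h1 h2 => h1 (D.Lsym _ _ _ _ h2)
    · exact fun h1 h2 => h1 (D.Lsym _ _ _ _ h2)
  soft a b ε δ h h' h1 h2 := (D.soft b a δ ε h' h h2 h1).symm
  hardh a b ε δ c i j h h' h1 hc hi hj l1 l2 := D.hardv b a δ ε c j i h' h h1 hc hj hi l1 l2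
  hardv a b ε δ c i j h h' h1 hc hi hj l1 l2 := D.hardh b a δ ε c j i h' h h1 hc hj hi l1 l2

theorem Cfg.flip (D : Cfg R L) :
    Cfg (fun x y x' y' => R (-x) y (-x') y') (fun x y x' y' => L (-x) y (-x') y') where
  Rx x y x' y' h := D.Rx _ _ _ _ h
  Ry x y x' y' h := D.Ry _ _ _ _ h
  ne x y x' y' h := by have := D.ne _ _ _ _ h; omega
  splitx x y x' y' x'' h h' := by
    have := D.splitx (-x'') y (-x') y' (-x) (by omega) (by omega)
    constructor
    · intro h
      have := this.1 (D.Rx _ _ _ _ h)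
      exact ⟨D.Rx _ _ _ _ this.2, D.Rx _ _ _ _ this.1⟩
    · intro h
      exact D.Rx _ _ _ _ (this.2 ⟨D.Rx _ _ _ _ h.2, D.Rx _ _ _ _ h.1⟩)
  splity x y x' y' y'' h h' := D.splity _ _ _ _ _ h h'
  no22 x y x' y' h := by have := D.no22 _ _ _ _ h; omega
  diag x y ε δ h h' h1 h2 := by
    have := D.diag (-x) y (-ε) δ h.neg h' (by convert h1 using 1; ring) (by convert h2 using 1; ring)
    convert this using 2 <;> ring
  Lsym x y x' y' h := D.Lsym _ _ _ _ h
  LR x y x' y' h := D.LR _ _ _ _ h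
  dich x y x' y' h := D.dich _ _ _ _ h
  soft a b ε δ h h' h1 h2 := by
    have := D.soft (-a) b (-ε) δ h.neg h' (by convert h1 using 1; ring) (by convert h2 using 1; ring)
    have e : -(a + ε) = -a + -ε := by ring
    simp only [e]
    exact this.imp (fun h c => h (-c)) (fun h => h)
  hardh a b ε δ c i j h h' h1 hc hi hj l1 l2 :=
    D.hardh (-a) b (-ε) δ c i j h.neg h' (by convert h1 using 1; ring) hc hi hj
      (by convert l1 using 1; ring) (by convert l2 using 1; ring)
  hardv a b ε δ c i j h h' h1 hc hi hj l1 l2 :=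
    D.hardv (-a) b (-ε) δ (-c) i j h.neg h' (by convert h1 using 1; ring)
      (by convert hc using 1; ring) hi hj
      (by convert l1 using 1; ring) (by convert l2 using 1; ring)

theorem Cfg.gx (D : Cfg R L) {x x' x'' y y' : ℤ} (h : (x < x' ∧ x' < x'') ∨ (x'' < x' ∧ x' < x)) :
    R x y x'' y' ↔ R x y x' y' ∧ R x' y x'' y' := by
  rcases h with h | h
  · exact D.splitx _ _ _ _ _ h.1 h.2
  · have := D.splitx x'' y x' y' x h.1 h.2
    have f := @Cfg.Rx _ _ D
    constructor
    · intro h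
      have := this.1 (f _ _ _ _ h)
      exact ⟨f _ _ _ _ this.2, f _ _ _ _ this.1⟩
    · intro h
      exact f _ _ _ _ (this.2 ⟨f _ _ _ _ h.2, f _ _ _ _ h.1⟩)

theorem Cfg.gy (D : Cfg R L) {x x' y y' y'' : ℤ} (h : (y < y' ∧ y' < y'') ∨ (y'' < y' ∧ y' < y)) :
    R x y x' y'' ↔ R x y x' y' ∧ R x y' x' y'' := D.transp.gx h

theorem Cfg.sy (D : Cfg R L) {x x' y y' : ℤ} : L x y x' y' ↔ L x' y' x y :=
  ⟨D.Lsym _ _ _ _, D.Lsym _ _ _ _⟩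

theorem Cfg.subx (D : Cfg R L) {x x' x'' y y' : ℤ} (h : R x y x'' y')
    (h' : (x < x' ∧ x' ≤ x'') ∨ (x'' ≤ x' ∧ x' < x)) : R x y x' y' := by
  rcases eq_or_ne x' x'' with rfl | e
  · exact h
  · exact ((D.gx (by omega)).1 h).1

theorem Cfg.suby (D : Cfg R L) {x x' y y' y'' : ℤ} (h : R x y x' y'')
    (h' : (y < y' ∧ y' ≤ y'') ∨ (y'' ≤ y' ∧ y' < y)) : R x y x' y' := D.transp.subx h h'

theorem Cfg.softc (D : Cfg R L) (a b a' b' c d : ℤ) (ha : a' = a + 1 ∨ a' = a - 1)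
    (hb : b' = b + 1 ∨ b' = b - 1) (hc : c - a = 2 * (a' - a)) (hd : d - b = 2 * (b' - b))
    (h1 : R a b c b') (h2 : R a b a' d) :
    (∀ c, R a' b c b' → R a b c b' → (L a b c b' ↔ L a' b c b')) ∨
    (∀ d, R a b' a' d → R a b a' d → (L a b a' d ↔ L a b' a' d)) := by
  have := D.soft a b (a' - a) (b' - b) (by unfold Sg; omega) (by unfold Sg; omega)
  have e1 : a + (a' - a) = a' := by ring
  have e2 : b + (b' - b) = b' := by ring
  have e3 : a + 2 * (a' - a) = c := by omega
  have e4 : b + 2 * (b' - b) = d := by omega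
  rw [e1, e2, e3, e4] at this
  exact this h1 h2

theorem Cfg.conf0 (D : Cfg R L) (a b m i j : ℤ) (hm : 1 ≤ m) (h1 : L a b (a + m) (b + 1))
    (h2 : L a b (a + i) (b + j)) (hne : ¬ (m = i ∧ j = 1)) :
    JJ R L a b (a + m) (b + 1) (a + i) (b + j) := by
  have R1 := D.LR _ _ _ _ h1
  have R2 := D.LR _ _ _ _ h2
  have N2 := D.no22 _ _ _ _ R2
  have fx := @Cfg.Rx _ _ D
  have fy := @Cfg.Ry _ _ D
  have ne2 := D.ne _ _ _ _ R2
  have swp : ∀ {x y x' y'}, R x y x' y' → R x' y' x y := fun h => fx _ _ _ _ (fy _ _ _ _ h)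
  by_cases hj1 : j = 1
  · subst hj1
    refine Or.inr (Or.inl ⟨rfl, ?_⟩)
    rcases lt_or_ge i 0 with hi | hi
    · exact (D.gx (x' := a) (by omega)).2 ⟨fx _ _ _ _ R1, R2⟩
    · rcases lt_or_gt_of_ne (show m ≠ i by omega) with h | h
      · exact ((D.gx (x' := a + m) (by omega)).1 R2).2
      · exact fx _ _ _ _ ((D.gx (x' := a + i) (by omega)).1 R1).2
  rcases lt_or_gt_of_ne (show j ≠ 0 by omega) with hj | hj
  · rcases lt_or_gt_of_ne (show i ≠ 0 by omega) with hi | hi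
    · -- opposite quadrants
      have C1 := D.subx (x' := a + 1) R1 (by omega)
      have C2 := D.suby (y' := b - 1) (D.subx (x' := a - 1) R2 (by omega)) (by omega)
      rcases D.diag a b 1 1 (Or.inl rfl) (Or.inl rfl) C1 C2 with C3 | C3
      · -- SE
        have hm1 : m = 1 := by
          by_contra hm1
          refine D.hardv a b 1 (-1) m (-i) (-j) (Or.inl rfl) (Or.inr rfl) C3 (by omega) (by omega)
            (by omega) (by simpa using h1) ?_
          convert h2 using 1 <;> ring
        subst hm1
        have hj1 : j = -1 := by
          by_contra hj1
          have hi : i = -1 := by omega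
          refine D.hardh a b 1 (-1) j 1 1 (Or.inl rfl) (Or.inr rfl) C3 (by omega) (by omega)
            (by omega) ?_ (by simpa using h1)
          convert h2 using 1; omega
        subst hj1
        have := D.softc (a+1) (b-1) a b (a-1) (b+1) (by omega) (by omega) (by omega) (by omega)
          ((D.gx (x' := a) (by omega)).2 ⟨fx _ _ _ _ (fy _ _ _ _ C3), fy _ _ _ _ C2⟩)
          ((D.gy (y' := b) (by omega)).2 ⟨fx _ _ _ _ (fy _ _ _ _ C3), fx _ _ _ _ C1⟩)
        refine Or.inr (Or.inr (Or.inr ⟨(D.gx (x' := a) (by omega)).2 ⟨fx _ _ _ _ C3, R2⟩,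
          (D.gy (y' := b) (by omega)).2 ⟨swp C1, fx _ _ _ _ C3⟩, ?_⟩))
        rintro ⟨l1, l2⟩
        rcases this with h | h
        · have h := h (a + i) (fy _ _ _ _ R2) ((D.gx (x' := a) (by omega)).2 ⟨swp C3, fy _ _ _ _ R2⟩)
          have e := (D.dich _ _ _ _ R2).1 h2
          exact e (h.1 (D.sy.1 l1))
        · have h := h (b + 1) (fx _ _ _ _ C1) ((D.gy (y' := b) (by omega)).2 ⟨swp C3, fx _ _ _ _ C1⟩)
          have e := (D.dich _ _ _ _ R1).1 h1
          exact e (D.sy.1 (h.1 (D.sy.1 l2)))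
      · -- NW
        have hi1 : i = -1 := by
          by_contra hi1
          have : j = -1 := by omega
          subst this
          refine D.hardv a b (-1) 1 i m 1 (Or.inr rfl) (Or.inl rfl) C3 (by omega) (by omega)
            (by omega) (by simpa [← sub_eq_add_neg] using h2) ?_
          convert h1 using 1 <;> ring
        subst hi1
        have := D.softc (a-1) (b+1) a b (a+1) (b-1) (by omega) (by omega) (by omega) (by omega)
          ((D.gx (x' := a) (by omega)).2 ⟨swp C3, fy _ _ _ _ C1⟩)
          ((D.gy (y' := b) (by omega)).2 ⟨swp C3, fx _ _ _ _ C2⟩)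
        have G1 : R a (b+1) (a-1) (b+j) :=
          (D.gy (y' := b) (by omega)).2 ⟨fy _ _ _ _ C3, R2⟩
        have G2 : R (a-1) b (a+m) (b+1) :=
          (D.gx (x' := a) (by omega)).2 ⟨fx _ _ _ _ C3, R1⟩
        refine Or.inr (Or.inr (Or.inl ⟨G1, swp G2, ?_⟩))
        rintro ⟨l1, l2⟩
        rcases this with h | h
        · have h := h (a + m) (fy _ _ _ _ R1) (fy _ _ _ _ G2)
          have e := (D.dich _ _ _ _ R1).1 h1
          exact e (h.1 (D.sy.1 l2))
        · have h := h (b + j) (fx _ _ _ _ R2) (fx _ _ _ _ G1)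
          have e := (D.dich _ _ _ _ R2).1 h2
          exact e (D.sy.1 (h.1 (D.sy.1 l1)))
    · -- p up right, s down right
      rcases eq_or_ne i m with rfl | him
      · exact Or.inl ⟨rfl, (D.gy (y' := b) (by omega)).2 ⟨fy _ _ _ _ R1, R2⟩⟩
      rcases lt_or_gt_of_ne him with him | him
      · have G1 : R a (b+1) (a+i) (b+j) := (D.gy (y' := b) (by omega)).2
          ⟨fy _ _ _ _ (D.subx (x' := a + i) R1 (by omega)), R2⟩
        have hi1 : i = 1 := by
          have := D.no22 _ _ _ _ G1
          omega
        subst hi1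
        have G2 : R (a+1) b (a+m) (b+1) := ((D.gx (x' := a+1) (by omega)).1 R1).2
        have := D.softc a (b+1) (a+1) b (a+2) (b-1) (by omega) (by omega) (by omega) (by omega)
          (D.subx (fy _ _ _ _ R1) (by omega)) (D.suby G1 (by omega))
        refine Or.inr (Or.inr (Or.inl ⟨G1, swp G2, ?_⟩))
        rintro ⟨l1, l2⟩
        rcases this with h | h
        · have h := h (a + m) (fy _ _ _ _ G2) (fy _ _ _ _ R1)
          have e := (D.dich _ _ _ _ R1).1 h1
          exact e (h.2 (D.sy.1 l2))
        · have h := h (b + j) R2 G1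
          have e := (D.dich _ _ _ _ G1).1 (h.2 h2)
          exact e l1
      · have G0 : R a (b+1) (a+m) (b+j) := (D.gy (y' := b) (by omega)).2
          ⟨fy _ _ _ _ R1, (D.subx R2 (by omega))⟩
        have hi1 : m = 1 := by
          have := D.no22 _ _ _ _ G0
          omega
        subst hi1
        have hj1 : j = -1 := by omega
        subst hj1
        have G1 : R (a+1) b (a+i) (b-1) := ((D.gx (x' := a+1) (by omega)).1 R2).2
        have := D.softc a (b-1) (a+1) b (a+2) (b+1) (by omega) (by omega) (by omega) (by omega)
          (D.subx (fy _ _ _ _ R2) (by omega)) (fy _ _ _ _ G0)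
        refine Or.inr (Or.inr (Or.inr ⟨G1, fx _ _ _ _ G0, ?_⟩))
        rintro ⟨l1, l2⟩
        rcases this with h | h
        · have h := h (a + i) (fy _ _ _ _ G1) (fy _ _ _ _ R2)
          have e := (D.dich _ _ _ _ R2).1 h2
          exact e (h.2 (D.sy.1 l1))
        · have h := h (b + 1) R1 (fy _ _ _ _ G0)
          have e := (D.dich _ _ _ _ (fy _ _ _ _ G0)).1 (h.2 h1)
          exact e l2
  · rcases lt_or_gt_of_ne (show i ≠ 0 by omega) with hi | hi
    · have hi1 : i = -1 := by omega
      subst hi1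
      have C3 : R (a-1) b a (b+1) := fx _ _ _ _ (D.suby R2 (by omega))
      have G1 : R a (b+1) (a-1) (b+j) := ((D.gy (y' := b+1) (by omega)).1 R2).2
      have G2 : R (a-1) b (a+m) (b+1) := (D.gx (x' := a) (by omega)).2 ⟨C3, R1⟩
      have := D.softc (a-1) b a (b+1) (a+1) (b+2) (by omega) (by omega) (by omega) (by omega)
        (D.subx G2 (by omega)) (D.suby (fx _ _ _ _ R2) (by omega))
      refine Or.inr (Or.inr (Or.inl ⟨G1, swp G2, ?_⟩))
      rintro ⟨l1, l2⟩
      rcases this with h | h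
      · have h := h (a + m) R1 G2
        have e := (D.dich _ _ _ _ G2).1 (h.2 h1)
        exact e (D.sy.1 l2)
      · have h := h (b + j) (fx _ _ _ _ G1) (fx _ _ _ _ R2)
        have e := (D.dich _ _ _ _ R2).1 h2
        exact e (D.sy.1 (h.2 (D.sy.1 l1)))
    · have hi1 : i = 1 := by omega
      subst hi1
      rcases eq_or_ne m 1 with rfl | hm1
      · exact Or.inl ⟨rfl, ((D.gy (y' := b+1) (by omega)).1 R2).2⟩
      have G1 : R a (b+1) (a+1) (b+j) := ((D.gy (y' := b+1) (by omega)).1 R2).2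
      have G2 : R (a+1) b (a+m) (b+1) := ((D.gx (x' := a+1) (by omega)).1 R1).2
      have := D.softc a b (a+1) (b+1) (a+2) (b+2) (by omega) (by omega) (by omega) (by omega)
        (D.subx R1 (by omega)) (D.suby R2 (by omega))
      refine Or.inr (Or.inr (Or.inl ⟨G1, swp G2, ?_⟩))
      rintro ⟨l1, l2⟩
      rcases this with h | h
      · have h := h (a + m) G2 R1
        have e := (D.dich _ _ _ _ G2).1 (h.1 h1)
        exact e (D.sy.1 l2)
      · have h := h (b + j) G1 R2
        have e := (D.dich _ _ _ _ G1).1 (h.1 h2)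
        exact e l1

theorem Cfg.conf1 (D : Cfg R L) (x y x' y' x'' y'' : ℤ) (hx : x < x') (hy : y < y')
    (h1 : L x y x' y') (h2 : L x y x'' y'') (hne : ¬ (x' = x'' ∧ y' = y'')) :
    JJ R L x y x' y' x'' y'' := by
  have hR := D.LR _ _ _ _ h1
  rcases D.no22 _ _ _ _ hR with h | h
  · have := D.transp.conf0 y x (y' - y) (y'' - y) (x'' - x) (by omega)
      (by
        have e1 : x + 1 = x' := by omega
        have e2 : y + (y' - y) = y' := by omega
        simpa only [e1, e2] using h1)
      (by
        have e1 : x + (x'' - x) = x'' := by omega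
        have e2 : y + (y'' - y) = y'' := by omega
        simpa only [e1, e2] using h2) (by omega)
    have e0 : x + 1 = x' := by omega
    have e1 : x + (x'' - x) = x'' := by omega
    have e2 : y + (y'' - y) = y'' := by omega
    have e3 : y + (y' - y) = y' := by omega
    rw [e0, e1, e2, e3] at this
    unfold JJ at this ⊢
    rcases this with h | h | h | h
    · exact Or.inr (Or.inl h)
    · exact Or.inl h
    · exact Or.inr (Or.inr (Or.inr h))
    · exact Or.inr (Or.inr (Or.inl h))
  · have e0 : y + 1 = y' := by omega
    have e1 : x + (x'' - x) = x'' := by omega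
    have e2 : y + (y'' - y) = y'' := by omega
    have e3 : x + (x' - x) = x' := by omega
    have := D.conf0 x y (x' - x) (x'' - x) (y'' - y) (by omega)
      (by rwa [e3, e0]) (by rwa [e1, e2]) (by omega)
    rwa [e0, e1, e2, e3] at this

theorem Cfg.conf2 (D : Cfg R L) (x y x' y' x'' y'' : ℤ) (hy : y < y')
    (h1 : L x y x' y') (h2 : L x y x'' y'') (hne : ¬ (x' = x'' ∧ y' = y'')) :
    JJ R L x y x' y' x'' y'' := by
  have hR := D.ne _ _ _ _ (D.LR _ _ _ _ h1)
  rcases lt_or_gt_of_ne hR.1 with h | h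
  · exact D.conf1 _ _ _ _ _ _ h hy h1 h2 hne
  · have := D.flip.conf1 (-x) y (-x') y' (-x'') y'' (by omega) hy (by simpa using h1)
      (by simpa using h2) (by omega)
    simpa [JJ] using this

theorem Cfg.conf (D : Cfg R L) (x y x' y' x'' y'' : ℤ)
    (h1 : L x y x' y') (h2 : L x y x'' y'') (hne : ¬ (x' = x'' ∧ y' = y'')) :
    JJ R L x y x' y' x'' y'' := by
  have hR := D.ne _ _ _ _ (D.LR _ _ _ _ h1)
  rcases lt_or_gt_of_ne hR.2 with h | h
  · exact D.conf2 _ _ _ _ _ _ h h1 h2 hne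
  · have := D.transp.flip.transp.conf2 x (-y) x' (-y') x'' (-y'') (by omega) (by simpa using h1)
      (by simpa using h2) (by omega)
    simpa [JJ] using this

end

section
variable {R L : ℤ → ℤ → ℤ → ℤ → Prop}

theorem Cfg.two (D : Cfg R L) {x y x' y' : ℤ} (h : R x y x' y') :
    L x y x' y' ∨ L x y' x' y := by
  have := D.dich _ _ _ _ h
  tauto

theorem step_of {x y x' y' : ℤ} (h : L x y x' y') (u α β : Pt →₀ ℕ)
    (h1 : α = u + (ee x y + ee x' y')) (h2 : β = u + (ee x y' + ee x' y)) :
    ReflTransGen (Step L) α β :=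
  ReflTransGen.single ⟨x, y, x', y', u, h, h1, h2⟩

theorem Cfg.join1 (D : Cfg R L) {x y x' y' : ℤ} (h : R x y x' y') (u α β : Pt →₀ ℕ)
    (h1 : α = u + (ee x y + ee x' y')) (h2 : β = u + (ee x y' + ee x' y)) :
    Join (ReflTransGen (Step L)) α β := by
  rcases D.two h with l | l
  · exact ⟨β, step_of l u _ _ h1 h2, .refl⟩
  · exact ⟨α, .refl, step_of l u _ _ h2 h1⟩

theorem Cfg.join2 (D : Cfg R L) {x y x' y' z w z' w' : ℤ} (h : R x y x' y') (h' : R z w z' w')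
    (hn : ¬ (L x y' x' y ∧ L z w' z' w))
    (u v α β γ : Pt →₀ ℕ)
    (h1 : α = u + (ee x y + ee x' y')) (h2 : γ = u + (ee x y' + ee x' y))
    (h3 : β = v + (ee z w + ee z' w')) (h4 : γ = v + (ee z w' + ee z' w)) :
    Join (ReflTransGen (Step L)) α β := by
  rcases D.two h with l | l
  · rcases D.two h' with l' | l'
    · exact ⟨γ, step_of l u _ _ h1 h2, step_of l' v _ _ h3 h4⟩
    · exact ⟨β, (step_of l u _ _ h1 h2).trans (step_of l' v _ _ h4 h3), .refl⟩
  · rcases D.two h' with l' | l'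
    · exact ⟨α, .refl, (step_of l' v _ _ h3 h4).trans (step_of l u _ _ h2 h1)⟩
    · exact absurd ⟨l, l'⟩ hn

theorem Cfg.loc (D : Cfg R L) (x y x' y' x'' y'' : ℤ) (h1 : L x y x' y') (h2 : L x y x'' y'')
    (hne : (x', y') ≠ (x'', y'')) (u : Pt →₀ ℕ) :
    Join (ReflTransGen (Step L)) (u + ee x'' y'' + (ee x y' + ee x' y))
      (u + ee x' y' + (ee x y'' + ee x'' y)) := by
  rcases D.conf x y x' y' x'' y'' h1 h2 (by simpa using hne) with ⟨rfl, h⟩ | ⟨rfl, h⟩ | ⟨h, h', hn⟩ | ⟨h, h', hn⟩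
  · exact D.join1 h (u + ee x' y) _ _ (by abel) (by abel)
  · exact D.join1 h (u + ee x y') _ _ (by abel) (by abel)
  · refine D.join2 h h' ?_ (u + ee x' y) (u + ee x y'') _ _
      (u + ee x' y + ee x y'' + ee x'' y') (by abel) (by abel) (by abel) (by abel)
    exact hn
  · refine D.join2 h h' ?_ (u + ee x y') (u + ee x'' y) _ _
      (u + ee x y' + ee x'' y + ee x' y'') (by abel) (by abel) (by abel) (by abel)
    rintro ⟨a, b⟩
    exact hn ⟨D.sy.1 a, D.sy.1 b⟩

end

/-- Oriented closed path structure on a set of cells. -/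
structure PathS (P : Finset Pt) (nx : Pt → Pt → Prop) : Prop where
  memL : ∀ {c d}, nx c d → c ∈ P
  memR : ∀ {c d}, nx c d → d ∈ P
  adj : ∀ {c d}, nx c d → cellAdj c d
  conn : ∀ {c d}, c ∈ P → d ∈ P → cellAdj c d → nx c d ∨ nx d c
  func : ∀ {c d d'}, nx c d → nx c d' → d = d'
  inj : ∀ {c c' d}, nx c d → nx c' d → c = c'
  asym : ∀ {c d}, nx c d → ¬ nx d c
  succ : ∀ {c}, c ∈ P → ∃ d, nx c d
  pred : ∀ {c}, c ∈ P → ∃ d, nx d c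
  no4 : ∀ {a b c d}, nx a b → nx b c → nx c d → nx d a → False
  two : ∀ {c d}, c ∈ P → d ∈ P → (cellVerts c ∩ cellVerts d).Nonempty → c ≠ d →
    ¬ cellAdj c d → ∃ e ∈ P, cellAdj c e ∧ cellAdj e d

theorem zmod_ne {n : ℕ} (hn : 5 < n) (k : ℕ) (hk : 0 < k) (hk' : k ≤ 5) : (k : ZMod n) ≠ 0 := by
  rw [Ne, ZMod.natCast_eq_zero_iff]
  intro h
  have := Nat.le_of_dvd hk h
  omega

theorem cellAdj_symm {a b : Pt} (h : cellAdj a b) : cellAdj b a := by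
  obtain ⟨a1, a2⟩ := a
  obtain ⟨b1, b2⟩ := b
  simp only [cellAdj, Prod.mk.injEq] at *
  omega

theorem cellAdj_parity {a b : Pt} (h : cellAdj a b) : (a.1 + a.2 + b.1 + b.2) % 2 = 1 := by
  obtain ⟨a1, a2⟩ := a
  obtain ⟨b1, b2⟩ := b
  simp only [cellAdj, Prod.mk.injEq] at *
  omega

theorem cellAdj_verts {a b : Pt} (h : cellAdj a b) : (cellVerts a ∩ cellVerts b).Nonempty := by
  obtain ⟨a1, a2⟩ := a
  obtain ⟨b1, b2⟩ := b
  simp only [cellAdj, Prod.mk.injEq] at h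
  simp only [cellVerts]
  rcases h with ⟨rfl, rfl⟩ | ⟨rfl, rfl⟩ | ⟨rfl, rfl⟩ | ⟨rfl, rfl⟩
  · exact ⟨(a1 + 1, b2), by simp, by simp⟩
  · exact ⟨(a1, b2), by simp, by simp⟩
  · exact ⟨(b1, a2 + 1), by simp, by simp⟩
  · exact ⟨(b1, a2), by simp, by simp⟩

theorem exists_pathS {P : Finset Pt} (hP : IsClosedPath P) : ∃ nx, PathS P nx := by
  obtain ⟨n, hn, A, hA, hadj, hdis, hmem⟩ := hP
  have z1 : (1 : ZMod n) ≠ 0 := by simpa using zmod_ne hn 1 (by omega) (by omega)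
  have z2 : (2 : ZMod n) ≠ 0 := by simpa using zmod_ne hn 2 (by omega) (by omega)
  have z3 : (3 : ZMod n) ≠ 0 := by simpa using zmod_ne hn 3 (by omega) (by omega)
  have z4 : (4 : ZMod n) ≠ 0 := by simpa using zmod_ne hn 4 (by omega) (by omega)
  have near : ∀ i j, (cellVerts (A i) ∩ cellVerts (A j)).Nonempty →
      j = i ∨ j = i + 1 ∨ i = j + 1 ∨ j = i + 1 + 1 ∨ i = j + 1 + 1 := by
    intro i j h
    by_contra hc
    push Not at hc
    obtain ⟨h0, h1, h2, h3, h4⟩ := hc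
    rw [hdis i j] at h
    · simp at h
    · rintro rfl; apply h4; ring
    · rintro rfl; apply h2; ring
    · exact h0
    · exact h1
    · rintro rfl; apply h3; ring
  have par2 : ∀ i, ¬ cellAdj (A i) (A (i + 1 + 1)) := by
    intro i h
    have h1 := cellAdj_parity h
    have h2 := cellAdj_parity (hadj i)
    have h3 := cellAdj_parity (hadj (i+1))
    omega
  refine ⟨fun c d => ∃ i, A i = c ∧ A (i + 1) = d, ?_⟩
  constructor
  · rintro c d ⟨i, rfl, rfl⟩; exact (hmem _).2 ⟨_, rfl⟩
  · rintro c d ⟨i, rfl, rfl⟩; exact (hmem _).2 ⟨_, rfl⟩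
  · rintro c d ⟨i, rfl, rfl⟩; exact hadj i
  · intro c d hc hd h
    obtain ⟨i, rfl⟩ := (hmem _).1 hc
    obtain ⟨j, rfl⟩ := (hmem _).1 hd
    rcases near i j (cellAdj_verts h) with rfl | rfl | rfl | rfl | rfl
    · have := cellAdj_parity h; omega
    · exact Or.inl ⟨i, rfl, rfl⟩
    · exact Or.inr ⟨j, rfl, rfl⟩
    · exact absurd h (par2 i)
    · exact absurd (cellAdj_symm h) (par2 j)
  · rintro c d d' ⟨i, rfl, rfl⟩ ⟨j, h, rfl⟩
    rw [hA h]
  · rintro c d d' ⟨i, rfl, rfl⟩ ⟨j, rfl, h⟩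
    rw [add_right_cancel (hA h)]
  · rintro c d ⟨i, rfl, rfl⟩ ⟨j, h, h'⟩
    have h := hA h
    have h' := hA h'
    subst h
    apply z2
    linear_combination h'
  · intro c hc
    obtain ⟨i, rfl⟩ := (hmem _).1 hc
    exact ⟨_, i, rfl, rfl⟩
  · intro c hc
    obtain ⟨i, rfl⟩ := (hmem _).1 hc
    exact ⟨_, i - 1, rfl, by ring_nf⟩
  · rintro a b c d ⟨i, rfl, rfl⟩ ⟨j, h, rfl⟩ ⟨k, h', rfl⟩ ⟨l, h1, h2⟩
    have h := hA h
    have h' := hA h'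
    have h1 := hA h1
    have h2 := hA h2
    subst h h' h1
    apply z4
    linear_combination h2
  · intro c d hc hd h hne hn
    obtain ⟨i, rfl⟩ := (hmem _).1 hc
    obtain ⟨j, rfl⟩ := (hmem _).1 hd
    rcases near i j h with rfl | rfl | rfl | rfl | rfl
    · exact absurd rfl hne
    · exact absurd (hadj i) hn
    · exact absurd (cellAdj_symm (hadj j)) hn
    · exact ⟨_, (hmem _).2 ⟨i + 1, rfl⟩, hadj _, hadj _⟩
    · exact ⟨_, (hmem _).2 ⟨j + 1, rfl⟩, cellAdj_symm (hadj _), cellAdj_symm (hadj _)⟩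

/-- Edge adjacency of cells, curried. -/
def Ad (x y x' y' : ℤ) : Prop :=
  (x' = x + 1 ∧ y' = y) ∨ (x' = x - 1 ∧ y' = y) ∨ (x' = x ∧ y' = y + 1) ∨ (x' = x ∧ y' = y - 1)

/-- Curried path structure. -/
structure PS (p : ℤ → ℤ → Prop) (N : ℤ → ℤ → ℤ → ℤ → Prop) : Prop where
  memL : ∀ {x y x' y'}, N x y x' y' → p x y
  memR : ∀ {x y x' y'}, N x y x' y' → p x' y'
  adj : ∀ {x y x' y'}, N x y x' y' → Ad x y x' y'
  conn : ∀ {x y x' y'}, p x y → p x' y' → Ad x y x' y' → N x y x' y' ∨ N x' y' x y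
  func : ∀ {x y x' y' x'' y''}, N x y x' y' → N x y x'' y'' → x' = x'' ∧ y' = y''
  inj : ∀ {x y x' y' x'' y''}, N x' y' x y → N x'' y'' x y → x' = x'' ∧ y' = y''
  asym : ∀ {x y x' y'}, N x y x' y' → ¬ N x' y' x y
  succ : ∀ {x y}, p x y → ∃ x' y', N x y x' y'
  pred : ∀ {x y}, p x y → ∃ x' y', N x' y' x y
  no22 : ∀ {x y}, p x y → p (x+1) y → p x (y+1) → p (x+1) (y+1) → False
  dg1 : ∀ {x y}, p x y → p (x+1) (y+1) → p (x+1) y ∨ p x (y+1)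
  dg2 : ∀ {x y}, p x y → p (x+1) (y-1) → p (x+1) y ∨ p x (y-1)

theorem PathS.toPS {P : Finset Pt} {nx : Pt → Pt → Prop} (H : PathS P nx) :
    PS (fun x y => (x, y) ∈ P) (fun x y x' y' => nx (x, y) (x', y')) where
  memL h := H.memL h
  memR h := H.memR h
  adj h := by simpa [cellAdj, Ad] using H.adj h
  conn h h' h'' := H.conn h h' (by simpa [cellAdj, Ad] using h'')
  func h h' := by simpa using H.func h h'
  inj h h' := by simpa using H.inj h h'
  asym h := H.asym h
  succ h := by obtain ⟨⟨a, b⟩, h⟩ := H.succ h; exact ⟨a, b, h⟩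
  pred h := by obtain ⟨⟨a, b⟩, h⟩ := H.pred h; exact ⟨a, b, h⟩
  no22 {x y} h1 h2 h3 h4 := by
    have e1 := H.conn h1 h2 (by simp [cellAdj])
    have e2 := H.conn h1 h3 (by simp [cellAdj])
    have e3 := H.conn h2 h4 (by simp [cellAdj])
    have e4 := H.conn h3 h4 (by simp [cellAdj])
    have n1 : ((x + 1, y) : Pt) ≠ (x, y + 1) := by simp
    have n2 : ((x, y) : Pt) ≠ (x + 1, y + 1) := by simp
    rcases e1 with e1 | e1
    · rcases e2 with e2 | e2
      · exact n1 (H.func e1 e2)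
      · rcases e3 with e3 | e3
        · rcases e4 with e4 | e4
          · exact n1 (H.inj e3 e4)
          · exact H.no4 e1 e3 e4 e2
        · exact n2 (H.inj e1 e3)
    · rcases e2 with e2 | e2
      · rcases e3 with e3 | e3
        · exact n2 (H.func e1 e3)
        · rcases e4 with e4 | e4
          · exact H.no4 e2 e4 e3 e1
          · exact n1 (H.func e3 e4)
      · exact n1 (H.inj e1 e2)
  dg1 {x y} h1 h2 := by
    obtain ⟨⟨a, b⟩, h, h3, h4⟩ := H.two h1 h2 ⟨(x+1, y+1), by simp [cellVerts], by simp [cellVerts]⟩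
      (by simp) (by simp [cellAdj])
    simp only [cellAdj, Prod.mk.injEq] at h3 h4
    have : (a = x + 1 ∧ b = y) ∨ (a = x ∧ b = y + 1) := by omega
    rcases this with ⟨rfl, rfl⟩ | ⟨rfl, rfl⟩
    · exact Or.inl h
    · exact Or.inr h
  dg2 {x y} h1 h2 := by
    obtain ⟨⟨a, b⟩, h, h3, h4⟩ := H.two h1 h2 ⟨(x+1, y), by simp [cellVerts], by simp [cellVerts]⟩
      (by simp) (by simp [cellAdj])
    simp only [cellAdj, Prod.mk.injEq] at h3 h4
    have : (a = x + 1 ∧ b = y) ∨ (a = x ∧ b = y - 1) := by omega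
    rcases this with ⟨rfl, rfl⟩ | ⟨rfl, rfl⟩
    · exact Or.inl h
    · exact Or.inr h

def SC1 (p : ℤ → ℤ → Prop) (x y : ℤ) : Prop := p x y ∧ p (x+1) y ∧ p x (y-1)
def SC2 (p : ℤ → ℤ → Prop) (x y : ℤ) : Prop := p x y ∧ p (x-1) y ∧ p x (y+1)
def SC (p : ℤ → ℤ → Prop) (x y : ℤ) : Prop := SC1 p x y ∨ SC2 p x y

section
variable (p : ℤ → ℤ → Prop) (N : ℤ → ℤ → ℤ → ℤ → Prop)

/-- predecessor is an S-corner -/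
def pS (x y : ℤ) : Prop := ∃ l m, N l m x y ∧ SC p l m
/-- successor is an S-corner -/
def sS (x y : ℤ) : Prop := ∃ l m, N x y l m ∧ SC p l m
/-- second of exactly two consecutive S-corners -/
def TT (x y : ℤ) : Prop :=
  SC p x y ∧ pS p N x y ∧ (∃ l m, N l m x y ∧ ¬ pS p N l m) ∧ ¬ sS p N x y
/-- the extra vertex of a cell -/
def zz (x y X W : ℤ) : Prop :=
  ((N x y (x+1) y ∨ N x y x (y+1)) ∧ X = x + 1 ∧ W = y + 1) ∨
  ((N x y (x-1) y ∨ N x y x (y-1)) ∧ X = x ∧ W = y)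
/-- the set `Y`, curried -/
def Yp (X W : ℤ) : Prop :=
  ∃ x y, (SC1 p x y ∧ pS p N x y ∧ X = x ∧ W = y + 1) ∨
    (SC2 p x y ∧ pS p N x y ∧ X = x + 1 ∧ W = y) ∨ (TT p N x y ∧ zz N x y X W)
end

section
variable {p : ℤ → ℤ → Prop} {N : ℤ → ℤ → ℤ → ℤ → Prop}

theorem PS.transp (H : PS p N) : PS (fun x y => p y x) (fun x y x' y' => N y x y' x') where
  memL h := H.memL h
  memR h := H.memR h
  adj h := by have := H.adj h; unfold Ad at *; omega
  conn h h' h'' := H.conn h h' (by unfold Ad at *; omega)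
  func h h' := (H.func h h').symm
  inj h h' := (H.inj h h').symm
  asym h := H.asym h
  succ h := by obtain ⟨a, b, h⟩ := H.succ h; exact ⟨b, a, h⟩
  pred h := by obtain ⟨a, b, h⟩ := H.pred h; exact ⟨b, a, h⟩
  no22 h1 h2 h3 h4 := H.no22 h1 h3 h2 h4
  dg1 h1 h2 := (H.dg1 h1 h2).symm
  dg2 {x y} h1 h2 := by
    have := H.dg2 (x := y - 1) (y := x + 1) h2 (by simpa using h1)
    simpa using this

theorem SC1_t (x y : ℤ) : SC1 (fun x y => p y x) x y ↔ SC2 p y x := by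
  unfold SC1 SC2; tauto
theorem SC2_t (x y : ℤ) : SC2 (fun x y => p y x) x y ↔ SC1 p y x := by
  unfold SC1 SC2; tauto
theorem SC_t (x y : ℤ) : SC (fun x y => p y x) x y ↔ SC p y x := by
  have h1 := SC1_t (p := p) x y
  have h2 := SC2_t (p := p) x y
  unfold SC; tauto
theorem pS_t (x y : ℤ) : pS (fun x y => p y x) (fun x y x' y' => N y x y' x') x y ↔ pS p N y x := by
  unfold pS; simp only [SC_t]; exact exists_comm
theorem sS_t (x y : ℤ) : sS (fun x y => p y x) (fun x y x' y' => N y x y' x') x y ↔ sS p N y x := by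
  unfold sS; simp only [SC_t]; exact exists_comm
theorem TT_t (x y : ℤ) : TT (fun x y => p y x) (fun x y x' y' => N y x y' x') x y ↔ TT p N y x := by
  unfold TT; simp only [SC_t, pS_t, sS_t]; rw [exists_comm]
theorem zz_t (x y X W : ℤ) : zz (fun x y x' y' => N y x y' x') x y X W ↔ zz N y x W X := by
  unfold zz; tauto
theorem Yp_t (X W : ℤ) : Yp (fun x y => p y x) (fun x y x' y' => N y x y' x') X W ↔ Yp p N W X := by
  unfold Yp; rw [exists_comm]
  refine exists_congr fun x => exists_congr fun y => ?_
  have h1 := SC1_t (p := p) y x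
  have h2 := SC2_t (p := p) y x
  rw [pS_t, TT_t, zz_t]; tauto

/-- at most two neighbours -/
theorem PS.deg (H : PS p N) {x y a b c d e f : ℤ} (h : p x y) (h1 : p a b) (h2 : p c d) (h3 : p e f)
    (a1 : Ad x y a b) (a2 : Ad x y c d) (a3 : Ad x y e f) (n12 : ¬ (a = c ∧ b = d))
    (n13 : ¬ (a = e ∧ b = f)) (n23 : ¬ (c = e ∧ d = f)) : False := by
  rcases H.conn h h1 a1 with e1 | e1 <;> rcases H.conn h h2 a2 with e2 | e2 <;>
  rcases H.conn h h3 a3 with e3 | e3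
  all_goals first
    | exact n12 (H.func e1 e2)
    | exact n13 (H.func e1 e3)
    | exact n23 (H.func e2 e3)
    | exact n12 (H.inj e1 e2)
    | exact n13 (H.inj e1 e3)
    | exact n23 (H.inj e2 e3)

theorem Ad.symm {x y x' y' : ℤ} (h : Ad x y x' y') : Ad x' y' x y := by
  unfold Ad at *; omega

/-- walking on -/
theorem PS.turn (H : PS p N) {a b x y e f : ℤ} (h : N a b x y) (h2 : p e f) (a2 : Ad x y e f)
    (n : ¬ (a = e ∧ b = f)) : N x y e f := by
  rcases H.conn (H.memR h) h2 a2 with e1 | e1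
  · exact e1
  · exact absurd (H.inj h e1) n

theorem PS.turn' (H : PS p N) {a b x y e f : ℤ} (h : N x y a b) (h2 : p e f) (a2 : Ad x y e f)
    (n : ¬ (a = e ∧ b = f)) : N e f x y := by
  rcases H.conn (H.memL h) h2 a2 with e1 | e1
  · exact absurd (H.func h e1) n
  · exact e1

theorem SC.mem {x y : ℤ} (h : SC p x y) : p x y := by
  rcases h with h | h <;> exact h.1

theorem PS.sc1 (H : PS p N) {x y : ℤ} (h : SC1 p x y) : ¬ p (x-1) y ∧ ¬ p x (y+1) := by
  obtain ⟨h, h1, h2⟩ := h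
  constructor <;> intro h3 <;>
  exact H.deg h h1 h2 h3 (by unfold Ad; omega) (by unfold Ad; omega) (by unfold Ad; omega) (by omega) (by omega) (by omega)

theorem PS.sc2 (H : PS p N) {x y : ℤ} (h : SC2 p x y) : ¬ p (x+1) y ∧ ¬ p x (y-1) := by
  obtain ⟨h, h1, h2⟩ := h
  constructor <;> intro h3 <;>
  exact H.deg h h1 h2 h3 (by unfold Ad; omega) (by unfold Ad; omega) (by unfold Ad; omega) (by omega) (by omega) (by omega)

/-- straight cells are not S-corners -/
theorem PS.strH (H : PS p N) {x y : ℤ} (h1 : p (x-1) y) (h2 : p (x+1) y) : ¬ SC p x y := by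
  rintro (h | h)
  · exact (H.sc1 h).1 h1
  · exact (H.sc2 h).1 h2
theorem PS.strV (H : PS p N) {x y : ℤ} (h1 : p x (y-1)) (h2 : p x (y+1)) : ¬ SC p x y := by
  rintro (h | h)
  · exact (H.sc1 h).2 h2
  · exact (H.sc2 h).2 h1

/-- Z corners are not S-corners -/
theorem PS.zc1 (H : PS p N) {x y : ℤ} (h1 : p (x+1) y) (h2 : p x (y+1)) : ¬ SC p x y := by
  rintro (h | h)
  · exact (H.sc1 h).2 h2
  · exact (H.sc2 h).1 h1
theorem PS.zc2 (H : PS p N) {x y : ℤ} (h1 : p (x-1) y) (h2 : p x (y-1)) : ¬ SC p x y := by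
  rintro (h | h)
  · exact (H.sc1 h).1 h1
  · exact (H.sc2 h).2 h2

theorem SC.s1 {x y : ℤ} (H : PS p N) (h : SC p x y) (h' : p (x+1) y ∨ p x (y-1)) : SC1 p x y := by
  rcases h with h | h
  · exact h
  · have := H.sc2 h; tauto
theorem SC.s2 {x y : ℤ} (H : PS p N) (h : SC p x y) (h' : p (x-1) y ∨ p x (y+1)) : SC2 p x y := by
  rcases h with h | h
  · have := H.sc1 h; tauto
  · exact h

/-- Classification of members of `Y` on a cell. -/
theorem PS.cls (H : PS p N) {X W x y : ℤ} (hY : Yp p N X W) (h : p x y)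
    (hX : X = x ∨ X = x + 1) (hW : W = y ∨ W = y + 1) :
    (SC1 p x y ∧ pS p N x y ∧ X = x ∧ W = y + 1) ∨
    (SC2 p x y ∧ pS p N x y ∧ X = x + 1 ∧ W = y) ∨ (TT p N x y ∧ zz N x y X W) ∨
    (∃ a b, N a b x y ∧ TT p N a b ∧ zz N a b X W ∧ ¬ SC p x y) := by
  obtain ⟨a, b, hY⟩ := hY
  by_cases hab : x = a ∧ y = b
  · obtain ⟨rfl, rfl⟩ := hab; tauto
  rcases hY with ⟨h1, h2, rfl, rfl⟩ | ⟨h1, h2, rfl, rfl⟩ | ⟨h1, h2⟩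
  · exfalso
    obtain ⟨e1, e2⟩ := H.sc1 h1
    have := @PS.dg2 _ _ H (X-1) (b+1)
    simp only [sub_add_cancel, add_sub_cancel_right] at this
    have e : ¬ p (X-1) (b+1) := fun h => by have := this h h1.1; tauto
    have : (x = X - 1 ∧ y = b) ∨ (x = X ∧ y = b + 1) ∨ (x = X - 1 ∧ y = b + 1) := by omega
    rcases this with ⟨rfl, rfl⟩ | ⟨rfl, rfl⟩ | ⟨rfl, rfl⟩ <;> tauto
  · exfalso
    obtain ⟨e1, e2⟩ := H.sc2 h1
    have := @PS.dg2 _ _ H a W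
    have e : ¬ p (a+1) (W-1) := fun h => by have := this h1.1 h; tauto
    have : (x = a + 1 ∧ y = W) ∨ (x = a ∧ y = W - 1) ∨ (x = a + 1 ∧ y = W - 1) := by omega
    rcases this with ⟨rfl, rfl⟩ | ⟨rfl, rfl⟩ | ⟨rfl, rfl⟩ <;> tauto
  · have hz := h2
    obtain ⟨hsc, -, -, hs⟩ := id h1
    rcases h2 with ⟨h2 | h2, rfl, rfl⟩ | ⟨h2 | h2, rfl, rfl⟩
    · have s1 := hsc.s1 H (Or.inl (H.memR h2))
      obtain ⟨e1, e2⟩ := H.sc1 s1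
      have ns : ¬ SC p (a+1) b := fun h => hs ⟨_, _, h2, h⟩
      have e3 : ¬ p (a+1) (b+1) := fun h => ns (Or.inr ⟨H.memR h2, by simpa using s1.1, h⟩)
      have : (x = a + 1 ∧ y = b) ∨ (x = a ∧ y = b + 1) ∨ (x = a + 1 ∧ y = b + 1) := by omega
      rcases this with ⟨rfl, rfl⟩ | ⟨rfl, rfl⟩ | ⟨rfl, rfl⟩
      · exact Or.inr (Or.inr (Or.inr ⟨_, _, h2, h1, hz, ns⟩))
      · exact absurd h e2
      · exact absurd h e3
    · have s1 := hsc.s2 H (Or.inr (H.memR h2))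
      obtain ⟨e1, e2⟩ := H.sc2 s1
      have ns : ¬ SC p a (b+1) := fun h => hs ⟨_, _, h2, h⟩
      have e3 : ¬ p (a+1) (b+1) := fun h => ns (Or.inl ⟨H.memR h2, h, by simpa using s1.1⟩)
      have : (x = a + 1 ∧ y = b) ∨ (x = a ∧ y = b + 1) ∨ (x = a + 1 ∧ y = b + 1) := by omega
      rcases this with ⟨rfl, rfl⟩ | ⟨rfl, rfl⟩ | ⟨rfl, rfl⟩
      · exact absurd h e1
      · exact Or.inr (Or.inr (Or.inr ⟨_, _, h2, h1, hz, ns⟩))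
      · exact absurd h e3
    · have s1 := hsc.s2 H (Or.inl (H.memR h2))
      obtain ⟨e1, e2⟩ := H.sc2 s1
      have ns : ¬ SC p (X-1) W := fun h => hs ⟨_, _, h2, h⟩
      have e3 : ¬ p (X-1) (W-1) := fun h => ns (Or.inl ⟨H.memR h2, by simpa using s1.1, h⟩)
      have : (x = X - 1 ∧ y = W) ∨ (x = X ∧ y = W - 1) ∨ (x = X - 1 ∧ y = W - 1) := by omega
      rcases this with ⟨rfl, rfl⟩ | ⟨rfl, rfl⟩ | ⟨rfl, rfl⟩
      · exact Or.inr (Or.inr (Or.inr ⟨_, _, h2, h1, hz, ns⟩))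
      · exact absurd h e2
      · exact absurd h e3
    · have s1 := hsc.s1 H (Or.inr (H.memR h2))
      obtain ⟨e1, e2⟩ := H.sc1 s1
      have ns : ¬ SC p X (W-1) := fun h => hs ⟨_, _, h2, h⟩
      have e3 : ¬ p (X-1) (W-1) := fun h => ns (Or.inr ⟨H.memR h2, h, by simpa using s1.1⟩)
      have : (x = X - 1 ∧ y = W) ∨ (x = X ∧ y = W - 1) ∨ (x = X - 1 ∧ y = W - 1) := by omega
      rcases this with ⟨rfl, rfl⟩ | ⟨rfl, rfl⟩ | ⟨rfl, rfl⟩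
      · exact absurd h e1
      · exact Or.inr (Or.inr (Or.inr ⟨_, _, h2, h1, hz, ns⟩))
      · exact absurd h e3

end

section
variable {p : ℤ → ℤ → Prop} {N : ℤ → ℤ → ℤ → ℤ → Prop}

theorem PS.neY (H : PS p N) {x y : ℤ} (h : p x y) (hY : Yp p N (x+1) (y+1)) :
    TT p N x y ∧ (N x y (x+1) y ∨ N x y x (y+1)) := by
  rcases H.cls hY h (by omega) (by omega) with h | h | ⟨h, h'⟩ | ⟨a, b, h1, h2, h3, h4⟩
  · omega
  · omega
  · refine ⟨h, ?_⟩
    rcases h' with h' | h'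
    · exact h'.1
    · omega
  · have := H.adj h1
    unfold Ad at this
    rcases h3 with h3 | h3 <;> omega

theorem PS.neYd (H : PS p N) {x y : ℤ} (h : p x y) (hY : Yp p N (x+1) (y+1)) (hd : p x (y-1)) :
    SC p x (y-1) ∧ ¬ pS p N x (y-1) := by
  obtain ⟨⟨h1, ⟨l, m, h2, h2s⟩, ⟨l', m', h3, h3s⟩, h4⟩, h5⟩ := H.neY h hY
  have s1 := h1.s1 H (Or.inr hd)
  have e := H.sc1 s1
  have h6 : N x y (x+1) y := by
    rcases h5 with h5 | h5
    · exact h5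
    · exact absurd (H.memR h5) e.2
  have h7 : N x (y-1) x y := H.turn' h6 hd (by unfold Ad; omega) (by omega)
  obtain ⟨rfl, rfl⟩ := H.inj h2 h7
  obtain ⟨rfl, rfl⟩ := H.inj h3 h7
  exact ⟨h2s, h3s⟩

theorem PS.neYl (H : PS p N) {x y : ℤ} (h : p x y) (hY : Yp p N (x+1) (y+1)) (hd : p (x-1) y) :
    SC p (x-1) y ∧ ¬ pS p N (x-1) y := by
  have := H.transp.neYd (x := y) (y := x) h (by rwa [Yp_t]) hd
  rwa [SC_t, pS_t] at this

theorem PS.sideY (H : PS p N) {x y X W e f : ℤ} (h : p x y) (hY : Yp p N X W)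
    (hw : (X = x ∧ W = y + 1) ∨ (X = x + 1 ∧ W = y)) (hd : p e f) (ha : Ad x y e f)
    (hn : ¬ ((X = e ∨ X = e + 1) ∧ (W = f ∨ W = f + 1))) : N x y e f ∨ SC p e f := by
  have key : pS p N x y → N x y e f ∨ SC p e f := by
    rintro ⟨l, m, h1, h2⟩
    by_cases hl : l = e ∧ m = f
    · obtain ⟨rfl, rfl⟩ := hl; exact Or.inr h2
    · exact Or.inl (H.turn h1 hd ha hl)
  rcases H.cls hY h (by omega) (by omega) with h | h | ⟨h, h'⟩ | ⟨a, b, h1, h2, h3, h4⟩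
  · exact key h.2.1
  · exact key h.2.1
  · rcases h' with h' | h' <;> omega
  · refine Or.inl (H.turn h1 hd ha ?_)
    rintro ⟨rfl, rfl⟩
    rcases h3 with h3 | h3 <;> omega

theorem PS.corn (H : PS p N) {a b x y ε δ : ℤ} (hs : SC p a b) (ha : Ad a b x y) (h : p x y)
    (hε : Sg ε) (hδ : Sg δ) (h1 : p (x+ε) y) (h2 : p x (y+δ)) : SC p x y := by
  have hab : (a = x + ε ∧ b = y) ∨ (a = x ∧ b = y + δ) := by
    by_contra hc
    unfold Sg at *
    exact H.deg h h1 h2 hs.mem (by unfold Ad; omega) (by unfold Ad; omega) ha.symm (by omega) (by omega) (by omega)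
  rcases hε with rfl | rfl <;> rcases hδ with rfl | rfl
  · exfalso
    rcases hab with ⟨rfl, rfl⟩ | ⟨rfl, rfl⟩
    · have := hs.s2 H (Or.inl (by simpa using h))
      exact H.no22 h h1 h2 this.2.2
    · have := hs.s1 H (Or.inr (by simpa using h))
      exact H.no22 h h1 h2 this.2.1
  · exact Or.inl ⟨h, h1, h2⟩
  · exact Or.inr ⟨h, h1, h2⟩
  · exfalso
    rw [← sub_eq_add_neg] at *
    rcases hab with ⟨rfl, rfl⟩ | ⟨rfl, rfl⟩
    · have := hs.s1 H (Or.inl (by simpa using h))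
      exact H.no22 (x := x-1) (y := b-1) this.2.2 (by simpa using h2) (by simpa using h1) (by simpa using h)
    · have := hs.s2 H (Or.inr (by simpa using h))
      exact H.no22 (x := a-1) (y := y-1) this.2.1 (by simpa using h2) (by simpa using h1) (by simpa using h)

theorem PS.noY (H : PS p N) {X W x y ε δ : ℤ} (h : p x y)
    (hε : Sg ε) (hδ : Sg δ) (h1 : p (x+ε) y) (h2 : p x (y+δ))
    (hn : ¬ (SC p x y ∧ (pS p N x y ∨ sS p N x y)))
    (hX : X = x ∨ X = x + 1) (hW : W = y ∨ W = y + 1) : ¬ Yp p N X W := by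
  intro hY
  rcases H.cls hY h hX hW with h | h | ⟨h, h'⟩ | ⟨a, b, h3, h4, h5, h6⟩
  · exact hn ⟨Or.inl h.1, Or.inl h.2.1⟩
  · exact hn ⟨Or.inr h.1, Or.inl h.2.1⟩
  · exact hn ⟨h.1, Or.inl h.2.1⟩
  · exact h6 (H.corn h4.1 (H.adj h3) h hε hδ h1 h2)

/-- anti-diagonal leading -/
def anti (Y : ℤ → ℤ → Prop) (x y x' y' : ℤ) : Prop := ¬ Y x' y' ∧ (Y x y' ∨ Y x' y)

def conR (p : ℤ → ℤ → Prop) (Y : ℤ → ℤ → Prop) (x y : ℤ) : Prop :=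
  ∀ c, x + 1 < c → (∀ t, x ≤ t → t < c → p t y) → (anti Y x y c (y+1) ↔ anti Y (x+1) y c (y+1))
def conL (p : ℤ → ℤ → Prop) (Y : ℤ → ℤ → Prop) (x y : ℤ) : Prop :=
  ∀ c, c < x → (∀ t, c ≤ t → t < x + 1 → p t y) → (anti Y c y (x+1) (y+1) ↔ anti Y c y x (y+1))
def conU (p : ℤ → ℤ → Prop) (Y : ℤ → ℤ → Prop) (x y : ℤ) : Prop :=
  ∀ c, y + 1 < c → (∀ t, y ≤ t → t < c → p x t) → (anti Y x y (x+1) c ↔ anti Y x (y+1) (x+1) c)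
def conD (p : ℤ → ℤ → Prop) (Y : ℤ → ℤ → Prop) (x y : ℤ) : Prop :=
  ∀ c, c < y → (∀ t, c ≤ t → t < y + 1 → p x t) → (anti Y x c (x+1) (y+1) ↔ anti Y x c (x+1) y)

theorem con_no {Y : ℤ → ℤ → Prop} {x y : ℤ}
    (h : ∀ X W, (X = x ∨ X = x + 1) → (W = y ∨ W = y + 1) → ¬ Y X W) :
    conR p Y x y ∧ conL p Y x y := by
  have h1 := h x y (by simp) (by simp)
  have h2 := h (x+1) y (by simp) (by simp)
  have h3 := h x (y+1) (by simp) (by simp)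
  have h4 := h (x+1) (y+1) (by simp) (by simp)
  constructor
  · intro c _ _; unfold anti; tauto
  · intro c _ _; unfold anti; tauto

/-- outer vertices -/
theorem out1 {x y : ℤ} (h : SC1 p x y) (h' : pS p N x y) : Yp p N x (y+1) :=
  ⟨x, y, Or.inl ⟨h, h', rfl, rfl⟩⟩
theorem out2 {x y : ℤ} (h : SC2 p x y) (h' : pS p N x y) : Yp p N (x+1) y :=
  ⟨x, y, Or.inr (Or.inl ⟨h, h', rfl, rfl⟩)⟩

theorem PS.soft1 (H : PS p N) {x y : ℤ} (h : SC1 p x y) :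
    conR p (Yp p N) x y ∨ conD p (Yp p N) x y := by
  obtain ⟨h0, hr, hd⟩ := id h
  have hrc : ∀ c, SC2 p (x+1) y → x + 1 < c → (∀ t, x ≤ t → t < c → p t y) → c = x + 2 := by
    intro c hc h1 h2
    by_contra h3
    exact (H.sc2 hc).1 (h2 _ (by omega) (by omega))
  have hdc : ∀ c, SC2 p x (y-1) → c < y → (∀ t, c ≤ t → t < y + 1 → p x t) → c = y - 1 := by
    intro c hc h1 h2
    by_contra h3
    exact (H.sc2 hc).2 (h2 _ (by omega) (by omega))
  -- right block
  have right : SC p (x+1) y → pS p N (x+1) y → conR p (Yp p N) x y := by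
    intro h1 h2 c hc hc'
    have s2 := h1.s2 H (Or.inl (by simpa using h0))
    obtain rfl := hrc c s2 hc hc'
    have := out2 s2 h2
    rw [show x + 1 + 1 = x + 2 by ring] at this
    unfold anti; tauto
  have down : SC p x (y-1) → pS p N x (y-1) → ¬ Yp p N (x+1) (y+1) → ¬ Yp p N (x+1) y →
      conD p (Yp p N) x y := by
    intro h1 h2 n1 n2 c hc hc'
    have s2 := h1.s2 H (Or.inr (by simpa using h0))
    obtain rfl := hdc c s2 hc hc'
    have := out2 s2 h2
    unfold anti; tauto
  by_cases hs : sS p N x y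
  · obtain ⟨l, m, h1, h2⟩ := id hs
    have hlm : (l = x + 1 ∧ m = y) ∨ (l = x ∧ m = y - 1) := by
      by_contra hc
      exact H.deg h0 hr hd (H.memR h1) (by unfold Ad; omega) (by unfold Ad; omega) (H.adj h1)
        (by omega) (by omega) (by omega)
    rcases hlm with ⟨rfl, rfl⟩ | ⟨rfl, rfl⟩
    · exact Or.inl (right h2 ⟨_, _, h1, Or.inl h⟩)
    · refine Or.inr (down h2 ⟨_, _, h1, Or.inl h⟩ ?_ ?_)
      · intro hY
        exact (H.neY h0 hY).1.2.2.2 hs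
      · intro hY
        have s2 := h2.s2 H (Or.inr (by simpa using h0))
        rcases (H.neY (y := y-1) hd (by simpa using hY)).2 with h3 | h3
        · exact (H.sc2 s2).1 (H.memR h3)
        · rw [sub_add_cancel] at h3
          exact H.asym h1 h3
  by_cases hp : pS p N x y
  · obtain ⟨l, m, h1, h2⟩ := id hp
    have hlm : (l = x + 1 ∧ m = y) ∨ (l = x ∧ m = y - 1) := by
      by_contra hc
      exact H.deg h0 hr hd (H.memL h1) (by unfold Ad; omega) (by unfold Ad; omega) (H.adj h1).symm
        (by omega) (by omega) (by omega)
    by_cases hpp : pS p N l m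
    · rcases hlm with ⟨rfl, rfl⟩ | ⟨rfl, rfl⟩
      · exact Or.inl (right h2 hpp)
      · refine Or.inr (down h2 hpp ?_ ?_)
        · intro hY
          obtain ⟨l', m', h3, h4⟩ := (H.neY h0 hY).1.2.2.1
          obtain ⟨rfl, rfl⟩ := H.inj h1 h3
          exact h4 hpp
        · intro hY
          exact (H.neY (y := y-1) hd (by simpa using hY)).1.2.2.2 ⟨_, _, h1, Or.inl h⟩
    · have hT : TT p N x y := ⟨Or.inl h, hp, ⟨l, m, h1, hpp⟩, hs⟩
      have ho := out1 h hp
      rcases hlm with ⟨rfl, rfl⟩ | ⟨rfl, rfl⟩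
      · have hN : N x m x (m-1) := H.turn h1 hd (by unfold Ad; omega) (by omega)
        have hz : Yp p N x m := ⟨x, m, Or.inr (Or.inr ⟨hT, Or.inr ⟨Or.inr hN, rfl, rfl⟩⟩)⟩
        refine Or.inr fun c hc hc' => ?_
        have n1 : ¬ Yp p N (x+1) (m+1) := by
          intro hY
          rcases (H.neY h0 hY).2 with h3 | h3
          · have := H.func hN h3; omega
          · have := H.func hN h3; omega
        have n2 : ¬ Yp p N (x+1) m := by
          intro hY
          have := (H.neY (y := m-1) hd (by simpa using hY)).1.1
          exact hs ⟨_, _, hN, this⟩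
        unfold anti; tauto
      · have hN : N l y (l+1) y := H.turn h1 hr (by unfold Ad; omega) (by omega)
        have hz : Yp p N (l+1) (y+1) := ⟨l, y, Or.inr (Or.inr ⟨hT, Or.inl ⟨Or.inl hN, rfl, rfl⟩⟩)⟩
        refine Or.inl fun c hc hc' => ?_
        unfold anti; tauto
  · exact Or.inl (con_no fun X W hX hW => H.noY (ε := 1) (δ := -1) h0 (Or.inl rfl) (Or.inr rfl) hr
      (by simpa [← sub_eq_add_neg] using hd) (by tauto) hX hW).1

theorem PS.soft2 (H : PS p N) {x y : ℤ} (h : SC2 p x y) :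
    conU p (Yp p N) x y ∨ conL p (Yp p N) x y := by
  have := H.transp.soft1 (x := y) (y := x) ((SC1_t y x).2 h)
  have e : Yp (fun x y => p y x) (fun x y x' y' => N y x y' x') = fun x y => Yp p N y x := by
    funext X W; exact propext (Yp_t X W)
  rw [e] at this
  refine this.imp ?_ ?_
  · intro h c hc hc'
    have := h c hc hc'
    unfold anti at *; tauto
  · intro h c hc hc'
    have := h c hc hc'
    unfold anti at *; tauto

theorem PS.softz (H : PS p N) {x y ε : ℤ} (h : p x y) (hε : Sg ε) (h1 : p (x+ε) y) (h2 : p x (y+ε)) :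
    conR p (Yp p N) x y ∧ conL p (Yp p N) x y := by
  refine con_no fun X W hX hW => H.noY h hε hε h1 h2 ?_ hX hW
  rintro ⟨h3, -⟩
  rcases hε with rfl | rfl
  · exact H.zc1 h1 h2 h3
  · exact H.zc2 h1 h2 h3

end

section
variable {p : ℤ → ℤ → Prop} {N : ℤ → ℤ → ℤ → ℤ → Prop}

theorem PS.propU (H : PS p N) {x y y' : ℤ} (hy : y < y') (h : ∀ t, y ≤ t → t ≤ y' → p x t)
    (h0 : N x y x (y+1)) : N x (y'-1) x y' := by
  obtain ⟨k, rfl⟩ := Int.le.dest (show y + 1 ≤ y' by omega)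
  clear hy
  induction k with
  | zero => simpa using h0
  | succ k ih =>
    have := ih (fun t h1 h2 => h t h1 (by push_cast; omega))
    have := H.turn (e := x) (f := y + 1 + (k : ℤ) + 1) this (h _ (by omega) (by push_cast; omega)) (by unfold Ad; omega) (by omega)
    convert this using 1 <;> (push_cast; ring)

theorem PS.propD (H : PS p N) {x y y' : ℤ} (hy : y < y') (h : ∀ t, y ≤ t → t ≤ y' → p x t)
    (h0 : N x y' x (y'-1)) : N x (y+1) x y := by
  obtain ⟨k, hk⟩ := Int.le.dest (show y + 1 ≤ y' by omega)
  clear hy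
  induction k generalizing y with
  | zero => 
    obtain rfl : y = y' - 1 := by simp at hk; omega
    simpa using h0
  | succ k ih =>
    have := ih (y := y + 1) (fun t h1 h2 => h t (by omega) h2) (by push_cast at hk; omega)
    exact H.turn this (h _ (by omega) (by push_cast at hk; omega)) (by unfold Ad; omega) (by omega)

theorem PS.armD (H : PS p N) {x y y' : ℤ} (hy : y < y') (h : ∀ t, y ≤ t → t ≤ y' → p x t)
    (hY : Yp p N x (y'+1)) (hs : ¬ SC p x y) : N x (y+1) x y := by
  refine H.propD hy h ?_
  rcases H.sideY (e := x) (f := y' - 1) (h y' (by omega) (by omega)) hY (by omega) (h _ (by omega) (by omega))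
    (by unfold Ad; omega) (by omega) with h1 | h1
  · exact h1
  · exfalso
    rcases eq_or_ne y (y'-1) with rfl | e
    · exact hs h1
    · exact H.strV (h _ (by omega) (by omega)) (h _ (by omega) (by omega)) h1

theorem PS.armU (H : PS p N) {x y y' : ℤ} (hy : y < y') (h : ∀ t, y ≤ t → t ≤ y' → p x t)
    (hY : Yp p N (x+1) y) (hs : ¬ SC p x y') : N x (y'-1) x y' := by
  refine H.propU hy h ?_
  rcases H.sideY (e := x) (f := y + 1) (h y (by omega) (by omega)) hY (by omega) (h _ (by omega) (by omega))
    (by unfold Ad; omega) (by omega) with h1 | h1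
  · exact h1
  · exfalso
    rcases eq_or_ne y' (y+1) with rfl | e
    · exact hs h1
    · exact H.strV (h _ (by omega) (by omega)) (h _ (by omega) (by omega)) h1

theorem PS.armL (H : PS p N) {x x' y : ℤ} (hy : x < x') (h : ∀ t, x ≤ t → t ≤ x' → p t y)
    (hY : Yp p N (x'+1) y) (hs : ¬ SC p x y) : N (x+1) y x y :=
  H.transp.armD hy h (by rwa [Yp_t]) (by rwa [SC_t])

theorem PS.armR (H : PS p N) {x x' y : ℤ} (hy : x < x') (h : ∀ t, x ≤ t → t ≤ x' → p t y)
    (hY : Yp p N x (y+1)) (hs : ¬ SC p x' y) : N (x'-1) y x' y :=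
  H.transp.armU hy h (by rwa [Yp_t]) (by rwa [SC_t])

theorem PS.hZ1 (H : PS p N) {a b k i j : ℤ} (hM : p a b) (hk : 2 ≤ k) (hi : 1 ≤ i) (hj : 1 ≤ j)
    (hf : ∀ s t, a - 1 ≤ s → s < a → b ≤ t → t < b + k → p s t)
    (hg : ∀ s t, a ≤ s → s < a + i → b - j ≤ t → t < b → p s t)
    (h1 : anti (Yp p N) (a-1) b a (b+k)) (h2 : anti (Yp p N) a (b-j) (a+i) b) : False := by
  have n1 := hf (a-1) b (by omega) (by omega) (by omega) (by omega)
  have n2 := hg a (b-1) (by omega) (by omega) (by omega) (by omega)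
  have nM := H.zc2 n1 n2
  have nv : ¬ Yp p N a b := H.noY (ε := -1) (δ := -1) hM (Or.inr rfl) (Or.inr rfl)
    (by simpa [← sub_eq_add_neg] using n1) (by simpa [← sub_eq_add_neg] using n2) (by tauto)
    (by omega) (by omega)
  have y1 : Yp p N (a-1) (b+k) := h1.2.resolve_right nv
  have y2 : Yp p N (a+i) (b-j) := h2.2.resolve_left nv
  have s1 : ¬ SC p (a-1) b := H.zc1 (by simpa using hM) (hf _ (b+1) (by omega) (by omega) (by omega) (by omega))
  have m1 := H.armD (x := a-1) (y := b) (y' := b+k-1) (by omega)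
    (fun t _ _ => hf _ t (by omega) (by omega) (by omega) (by omega)) (by simpa using y1) s1
  have r1 := H.turn m1 hM (by unfold Ad; omega) (by omega)
  have r2 : N a (b-1) a b := by
    rcases eq_or_ne i 1 with rfl | hi1
    · refine H.armU (x := a) (y := b-j) (y' := b) (by omega) (fun t _ _ => ?_) y2 nM
      rcases eq_or_ne t b with rfl | e
      · exact hM
      · exact hg _ _ (by omega) (by omega) (by omega) (by omega)
    · have s2 : ¬ SC p a (b-1) := H.zc1 (hg _ _ (by omega) (by omega) (by omega) (by omega)) (by simpa using hM)
      have hj1 : j = 1 := by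
        by_contra hj1
        exact H.no22 (x := a) (y := b - 2) (hg _ _ (by omega) (by omega) (by omega) (by omega))
          (hg _ _ (by omega) (by omega) (by omega) (by omega)) (hg _ _ (by omega) (by omega) (by omega) (by omega))
          (hg _ _ (by omega) (by omega) (by omega) (by omega))
      subst hj1
      have := H.armL (x := a) (x' := a + i - 1) (y := b-1) (by omega)
        (fun t _ _ => hg _ _ (by omega) (by omega) (by omega) (by omega)) (by simpa using y2) s2
      exact H.turn this hM (by unfold Ad; omega) (by omega)
  have := H.inj r1 r2
  omega

theorem PS.hZ2 (H : PS p N) {a b k i j : ℤ} (hM : p (a-1) (b-1)) (hk : 2 ≤ k) (hi : 1 ≤ i) (hj : 1 ≤ j)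
    (hf : ∀ s t, a ≤ s → s < a + 1 → b - k ≤ t → t < b → p s t)
    (hg : ∀ s t, a - i ≤ s → s < a → b ≤ t → t < b + j → p s t)
    (h1 : anti (Yp p N) a (b-k) (a+1) b) (h2 : anti (Yp p N) (a-i) b a (b+j)) : False := by
  have n1 := hf a (b-1) (by omega) (by omega) (by omega) (by omega)
  have n2 := hg (a-1) b (by omega) (by omega) (by omega) (by omega)
  have nM : ¬ SC p (a-1) (b-1) := H.zc1 (by simpa using n1) (by simpa using n2)
  have nv : ¬ Yp p N a b := H.noY (ε := 1) (δ := 1) hM (Or.inl rfl) (Or.inl rfl)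
    (by simpa using n1) (by simpa using n2) (by tauto)
    (by omega) (by omega)
  have y1 : Yp p N (a+1) (b-k) := h1.2.resolve_left nv
  have y2 : Yp p N (a-i) (b+j) := h2.2.resolve_right nv
  have s1 : ¬ SC p a (b-1) := H.zc2 (by simpa using hM) (hf _ _ (by omega) (by omega) (by omega) (by omega))
  have m1 := H.armU (x := a) (y := b-k) (y' := b-1) (by omega)
    (fun t _ _ => hf _ t (by omega) (by omega) (by omega) (by omega)) y1 s1
  have r1 := H.turn m1 hM (by unfold Ad; omega) (by omega)
  have r2 : N (a-1) b (a-1) (b-1) := by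
    rcases eq_or_ne i 1 with rfl | hi1
    · have := H.armD (x := a-1) (y := b-1) (y' := b+j-1) (by omega) (fun t _ _ => ?_) (by simpa using y2) nM
      · simpa using this
      rcases eq_or_ne t (b-1) with rfl | e
      · exact hM
      · exact hg _ _ (by omega) (by omega) (by omega) (by omega)
    · have s2 : ¬ SC p (a-1) b := H.zc2 (hg _ _ (by omega) (by omega) (by omega) (by omega)) hM
      have hj1 : j = 1 := by
        by_contra hj1
        exact H.no22 (x := a - 2) (y := b) (hg _ _ (by omega) (by omega) (by omega) (by omega))
          (hg _ _ (by omega) (by omega) (by omega) (by omega)) (hg _ _ (by omega) (by omega) (by omega) (by omega))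
          (hg _ _ (by omega) (by omega) (by omega) (by omega))
      subst hj1
      have := H.armR (x := a - i) (x' := a - 1) (y := b) (by omega)
        (fun t _ _ => hg _ _ (by omega) (by omega) (by omega) (by omega)) y2 s2
      exact H.turn this hM (by unfold Ad; omega) (by omega)
  have := H.inj r1 r2
  omega

/-- the hinge vertex of an S-corner is not in `Y` -/
theorem PS.hinge1 (H : PS p N) {x y : ℤ} (h : SC1 p x y) : ¬ Yp p N (x+1) y := by
  intro hY
  rcases H.cls hY h.1 (by omega) (by omega) with h' | h' | ⟨-, h'⟩ | ⟨_, _, _, _, _, h'⟩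
  · omega
  · exact (H.sc1 h).1 h'.1.2.1
  · rcases h' with h' | h' <;> omega
  · exact h' (Or.inl h)

theorem PS.hinge2 (H : PS p N) {x y : ℤ} (h : SC2 p x y) : ¬ Yp p N x (y+1) := by
  intro hY
  rcases H.cls hY h.1 (by omega) (by omega) with h' | h' | ⟨-, h'⟩ | ⟨_, _, _, _, _, h'⟩
  · exact (H.sc2 h).1 h'.1.2.1
  · omega
  · rcases h' with h' | h' <;> omega
  · exact h' (Or.inr h)

/-- column going up from a cell which is not the beginning of a pair -/
theorem PS.colNE (H : PS p N) {x y k : ℤ} (hk : 2 ≤ k) (h : ∀ t, y ≤ t → t < y + k → p x t)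
    (hs : ¬ (SC p x y ∧ ¬ pS p N x y)) : ¬ Yp p N (x+1) (y+k) := by
  intro hY
  have := H.neYd (x := x) (y := y+k-1) (h _ (by omega) (by omega)) (by simpa using hY)
    (h _ (by omega) (by omega))
  rcases eq_or_ne k 2 with rfl | e
  · rw [show y + 2 - 1 - 1 = y by ring] at this
    exact hs this
  · exact H.strV (h _ (by omega) (by omega)) (h _ (by omega) (by omega)) this.1

theorem PS.rowNE (H : PS p N) {x y k : ℤ} (hk : 2 ≤ k) (h : ∀ t, x ≤ t → t < x + k → p t y)
    (hs : ¬ (SC p x y ∧ ¬ pS p N x y)) : ¬ Yp p N (x+k) (y+1) := by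
  have := H.transp.colNE (x := y) (y := x) hk h (by rwa [SC_t, pS_t])
  rwa [Yp_t] at this

theorem PS.hS1 (H : PS p N) {a b k i j : ℤ} (hM : p a (b-1)) (hk : 2 ≤ k) (hi : 1 ≤ i) (hj : 1 ≤ j)
    (hf : ∀ s t, a - 1 ≤ s → s < a → b - k ≤ t → t < b → p s t)
    (hg : ∀ s t, a ≤ s → s < a + i → b ≤ t → t < b + j → p s t) :
    anti (Yp p N) (a-1) (b-k) a b ∨ anti (Yp p N) a b (a+i) (b+j) := by
  have n1 := hf (a-1) (b-1) (by omega) (by omega) (by omega) (by omega)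
  have n2 := hg a b (by omega) (by omega) (by omega) (by omega)
  have sM : SC2 p a (b-1) := ⟨hM, n1, by simpa using n2⟩
  have s1 : SC1 p (a-1) (b-1) := ⟨n1, by simpa using hM, hf _ _ (by omega) (by omega) (by omega) (by omega)⟩
  have nv : ¬ Yp p N a b := by simpa using H.hinge2 sM
  by_cases hp : pS p N (a-1) (b-1)
  · left
    have := out1 s1 hp
    rw [sub_add_cancel] at this
    exact ⟨nv, Or.inl this⟩
  right
  have e1 : N (a-1) (b-1) a (b-1) := by
    rcases H.conn n1 hM (by unfold Ad; omega) with h | h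
    · exact h
    · exact absurd ⟨_, _, h, Or.inr sM⟩ hp
  have e2 : N a (b-1) a b := H.turn e1 n2 (by unfold Ad; omega) (by omega)
  have pM : pS p N a (b-1) := ⟨_, _, e1, Or.inl s1⟩
  have pN : pS p N a b := ⟨_, _, e2, Or.inr sM⟩
  by_cases s2 : SC p a b
  · have s2' := s2.s1 H (Or.inr hM)
    have hj1 : j = 1 := by
      by_contra hj1
      exact (H.sc1 s2').2 (hg _ _ (by omega) (by omega) (by omega) (by omega))
    subst hj1
    refine ⟨?_, Or.inl (out1 s2' pN)⟩
    rcases eq_or_ne i 1 with rfl | hi1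
    · intro hY
      obtain ⟨l, m, h3, h4⟩ := (H.neY n2 hY).1.2.2.1
      obtain ⟨rfl, rfl⟩ := H.inj e2 h3
      exact h4 pM
    · exact H.rowNE (by omega) (fun t _ _ => hg _ _ (by omega) (by omega) (by omega) (by omega)) (by tauto)
  · have hT : TT p N a (b-1) := by
      refine ⟨Or.inr sM, pM, ⟨_, _, e1, hp⟩, ?_⟩
      rintro ⟨l, m, h3, h4⟩
      obtain ⟨rfl, rfl⟩ := H.func e2 h3
      exact s2 h4
    have hz : Yp p N (a+1) b :=
      ⟨a, b-1, Or.inr (Or.inr ⟨hT, Or.inl ⟨Or.inr (by simpa using e2), rfl, by ring⟩⟩)⟩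
    have hi1 : i = 1 := by
      by_contra hi1
      exact s2 (Or.inl ⟨n2, hg _ _ (by omega) (by omega) (by omega) (by omega), hM⟩)
    subst hi1
    refine ⟨?_, Or.inr hz⟩
    rcases eq_or_ne j 1 with rfl | hj1
    · intro hY
      exact s2 (H.neY n2 hY).1.1
    · exact H.colNE (by omega) (fun t _ _ => hg _ _ (by omega) (by omega) (by omega) (by omega)) (by tauto)

theorem PS.hS2 (H : PS p N) {a b k i j : ℤ} (hM : p (a-1) b) (hk : 2 ≤ k) (hi : 1 ≤ i) (hj : 1 ≤ j)
    (hf : ∀ s t, a ≤ s → s < a + 1 → b ≤ t → t < b + k → p s t)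
    (hg : ∀ s t, a - i ≤ s → s < a → b - j ≤ t → t < b → p s t) :
    anti (Yp p N) a b (a+1) (b+k) ∨ anti (Yp p N) (a-i) (b-j) a b := by
  have n1 := hf a b (by omega) (by omega) (by omega) (by omega)
  have n2 := hg (a-1) (b-1) (by omega) (by omega) (by omega) (by omega)
  have sM : SC1 p (a-1) b := ⟨hM, by simpa using n1, n2⟩
  have s1 : SC2 p a b := ⟨n1, hM, hf _ _ (by omega) (by omega) (by omega) (by omega)⟩
  have nv : ¬ Yp p N a b := by simpa using H.hinge1 sM
  by_cases hp : pS p N a b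
  · left
    have := out2 s1 hp
    exact ⟨H.colNE hk (fun t _ _ => hf _ _ (by omega) (by omega) (by omega) (by omega)) (by tauto), Or.inr this⟩
  right
  refine ⟨nv, ?_⟩
  have e1 : N a b (a-1) b := by
    rcases H.conn n1 hM (by unfold Ad; omega) with h | h
    · exact h
    · exact absurd ⟨_, _, h, Or.inl sM⟩ hp
  have e2 : N (a-1) b (a-1) (b-1) := H.turn e1 n2 (by unfold Ad; omega) (by omega)
  have pM : pS p N (a-1) b := ⟨_, _, e1, Or.inr s1⟩
  have pN : pS p N (a-1) (b-1) := ⟨_, _, e2, Or.inl sM⟩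
  by_cases s2 : SC p (a-1) (b-1)
  · have s2' := s2.s2 H (Or.inr (by simpa using hM))
    have hj1 : j = 1 := by
      by_contra hj1
      exact (H.sc2 s2').2 (hg _ _ (by omega) (by omega) (by omega) (by omega))
    subst hj1
    have := out2 s2' pN
    rw [sub_add_cancel] at this
    exact Or.inr this
  · have hT : TT p N (a-1) b := by
      refine ⟨Or.inl sM, pM, ⟨_, _, e1, hp⟩, ?_⟩
      rintro ⟨l, m, h3, h4⟩
      obtain ⟨rfl, rfl⟩ := H.func e2 h3
      exact s2 h4
    have hz : Yp p N (a-1) b :=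
      ⟨a-1, b, Or.inr (Or.inr ⟨hT, Or.inr ⟨Or.inr e2, rfl, rfl⟩⟩)⟩
    have hi1 : i = 1 := by
      by_contra hi1
      exact s2 (Or.inr ⟨n2, hg _ _ (by omega) (by omega) (by omega) (by omega), by simpa using hM⟩)
    subst hi1
    exact Or.inl hz

end

/-- inner rectangles by opposite corners -/
def Rq (p : ℤ → ℤ → Prop) (x y x' y' : ℤ) : Prop :=
  x ≠ x' ∧ y ≠ y' ∧ ∀ s t, min x x' ≤ s → s < max x x' → min y y' ≤ t → t < max y y' → p s t

/-- leading pairs -/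
def Lq (p Y : ℤ → ℤ → Prop) (x y x' y' : ℤ) : Prop :=
  Rq p x y x' y' ∧
    ((x < x' ↔ y < y') ↔ ¬ anti Y (min x x') (min y y') (max x x') (max y y'))

section
variable {p Y : ℤ → ℤ → Prop} {N : ℤ → ℤ → ℤ → ℤ → Prop}

theorem anti_t {x y x' y' : ℤ} : anti (fun x y => Y y x) x y x' y' ↔ anti Y y x y' x' := by
  unfold anti; tauto

theorem Rq_t {x y x' y' : ℤ} : Rq (fun x y => p y x) x y x' y' ↔ Rq p y x y' x' := by
  unfold Rq
  constructor
  · rintro ⟨h1, h2, h3⟩; exact ⟨h2, h1, fun s t a b c d => h3 t s c d a b⟩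
  · rintro ⟨h1, h2, h3⟩; exact ⟨h2, h1, fun s t a b c d => h3 t s c d a b⟩

theorem Lq_t {x y x' y' : ℤ} :
    Lq (fun x y => p y x) (fun x y => Y y x) x y x' y' ↔ Lq p Y y x y' x' := by
  unfold Lq
  rw [Rq_t, anti_t]; tauto

theorem Rq_x {x y x' y' : ℤ} (h : Rq p x y x' y') : Rq p x' y x y' := by
  unfold Rq at *
  rw [min_comm x' x, max_comm x' x]
  exact ⟨h.1.symm, h.2⟩

theorem Rq_y {x y x' y' : ℤ} (h : Rq p x y x' y') : Rq p x y' x' y := by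
  unfold Rq at *
  rw [min_comm y' y, max_comm y' y]
  exact ⟨h.1, h.2.1.symm, h.2.2⟩

theorem Rq_lt {x y x' y' : ℤ} (hx : x < x') (hy : y < y') :
    Rq p x y x' y' ↔ ∀ s t, x ≤ s → s < x' → y ≤ t → t < y' → p s t := by
  unfold Rq
  rw [min_eq_left hx.le, min_eq_left hy.le, max_eq_right hx.le, max_eq_right hy.le]
  exact ⟨fun h => h.2.2, fun h => ⟨hx.ne, hy.ne, h⟩⟩

theorem Rq_mem {x y x' y' s t : ℤ} (h : Rq p x y x' y')
    (hs : (x ≤ s ∧ s < x') ∨ (x' ≤ s ∧ s < x)) (ht : (y ≤ t ∧ t < y') ∨ (y' ≤ t ∧ t < y)) :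
    p s t := h.2.2 s t (by omega) (by omega) (by omega) (by omega)

theorem Rq_of {x y x' y' : ℤ} (hx : x ≠ x') (hy : y ≠ y')
    (h : ∀ s t, ((x ≤ s ∧ s < x') ∨ (x' ≤ s ∧ s < x)) → ((y ≤ t ∧ t < y') ∨ (y' ≤ t ∧ t < y)) → p s t) :
    Rq p x y x' y' := ⟨hx, hy, fun s t _ _ _ _ => h s t (by omega) (by omega)⟩

theorem Rq_split {x y x' y' x'' : ℤ} (h : x < x') (h' : x' < x'') :
    Rq p x y x'' y' ↔ Rq p x y x' y' ∧ Rq p x' y x'' y' := by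
  constructor
  · intro H
    exact ⟨Rq_of (by omega) H.2.1 fun s t hs ht => Rq_mem H (by omega) ht,
      Rq_of (by omega) H.2.1 fun s t hs ht => Rq_mem H (by omega) ht⟩
  · rintro ⟨H1, H2⟩
    refine Rq_of (by omega) H1.2.1 fun s t hs ht => ?_
    rcases lt_or_ge s x' with h | h
    · exact Rq_mem H1 (by omega) ht
    · exact Rq_mem H2 (by omega) ht

theorem Lq_eq {x y x' y' x0 y0 x1 y1 : ℤ} (hx : (x = x0 ∧ x' = x1) ∨ (x = x1 ∧ x' = x0))
    (hy : (y = y0 ∧ y' = y1) ∨ (y = y1 ∧ y' = y0)) (h0 : x0 < x1) (h1 : y0 < y1) :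
    Lq p Y x y x' y' ↔ Rq p x y x' y' ∧ ((x < x' ↔ y < y') ↔ ¬ anti Y x0 y0 x1 y1) := by
  unfold Lq
  have e1 : min x x' = x0 := by omega
  have e2 : max x x' = x1 := by omega
  have e3 : min y y' = y0 := by omega
  have e4 : max y y' = y1 := by omega
  rw [e1, e2, e3, e4]

theorem softR {x y y1 y2 c : ℤ} (h : conR p Y x y) (hl : ¬ p (x-1) y)
    (hy : (y1 = y ∧ y2 = y + 1) ∨ (y1 = y + 1 ∧ y2 = y)) (h1 : Rq p (x+1) y1 c y2)
    (h2 : Rq p x y1 c y2) : Lq p Y x y1 c y2 ↔ Lq p Y (x+1) y1 c y2 := by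
  have hc : x + 1 < c := by
    by_contra hc
    have := h1.1
    have := h2.1
    exact hl (Rq_mem h2 (by omega) (by omega))
  rw [Lq_eq (x0 := x) (x1 := c) (y0 := y) (y1 := y+1) (by omega) (by omega) (by omega) (by omega),
    Lq_eq (x0 := x+1) (x1 := c) (y0 := y) (y1 := y+1) (by omega) (by omega) (by omega) (by omega),
    h c hc (fun t _ _ => Rq_mem h2 (by omega) (by omega))]
  have a1 : x < c := by omega
  simp only [h1, h2, hc, a1]

theorem softL {x y y1 y2 c : ℤ} (h : conL p Y x y) (hl : ¬ p (x+1) y)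
    (hy : (y1 = y ∧ y2 = y + 1) ∨ (y1 = y + 1 ∧ y2 = y)) (h1 : Rq p x y1 c y2)
    (h2 : Rq p (x+1) y1 c y2) : Lq p Y (x+1) y1 c y2 ↔ Lq p Y x y1 c y2 := by
  have hc : c < x := by
    by_contra hc
    have := h1.1
    have := h2.1
    exact hl (Rq_mem h2 (by omega) (by omega))
  rw [Lq_eq (x0 := c) (x1 := x+1) (y0 := y) (y1 := y+1) (by omega) (by omega) (by omega) (by omega),
    Lq_eq (x0 := c) (x1 := x) (y0 := y) (y1 := y+1) (by omega) (by omega) (by omega) (by omega),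
    h c hc (fun t _ _ => Rq_mem h2 (by omega) (by omega))]
  have a1 : ¬ x < c := by omega
  have a2 : ¬ x + 1 < c := by omega
  simp only [h1, h2, a1, a2]

theorem softU {y x x1 x2 c : ℤ} (h : conU p Y x y) (hl : ¬ p x (y-1))
    (hx : (x1 = x ∧ x2 = x + 1) ∨ (x1 = x + 1 ∧ x2 = x)) (h1 : Rq p x1 (y+1) x2 c)
    (h2 : Rq p x1 y x2 c) : Lq p Y x1 y x2 c ↔ Lq p Y x1 (y+1) x2 c := by
  have := softR (p := fun x y => p y x) (Y := fun x y => Y y x) (x := y) (y := x) (c := c)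
    (fun c hc hc' => (anti_t (Y := Y)).trans ((h c hc hc').trans (anti_t (Y := Y)).symm)) hl hx (Rq_t.2 h1) (Rq_t.2 h2)
  exact (Lq_t (p := p) (Y := Y)).symm.trans (this.trans (Lq_t (p := p) (Y := Y)))

theorem softD {y x x1 x2 c : ℤ} (h : conD p Y x y) (hl : ¬ p x (y+1))
    (hx : (x1 = x ∧ x2 = x + 1) ∨ (x1 = x + 1 ∧ x2 = x)) (h1 : Rq p x1 y x2 c)
    (h2 : Rq p x1 (y+1) x2 c) : Lq p Y x1 (y+1) x2 c ↔ Lq p Y x1 y x2 c := by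
  have := softL (p := fun x y => p y x) (Y := fun x y => Y y x) (x := y) (y := x) (c := c)
    (fun c hc hc' => (anti_t (Y := Y)).trans ((h c hc hc').trans (anti_t (Y := Y)).symm)) hl hx (Rq_t.2 h1) (Rq_t.2 h2)
  exact (Lq_t (p := p) (Y := Y)).symm.trans (this.trans (Lq_t (p := p) (Y := Y)))

theorem PS.hardh (H : PS p N) (a b ε δ c i j : ℤ) (hε : Sg ε) (hδ : Sg δ)
    (hM : Rq p a b (a + ε) (b + δ)) (hc : 0 < δ * c - 1) (hi : 0 < i) (hj : 0 < j)
    (h1 : Lq p (Yp p N) a b (a - ε) (b + c)) (h2 : Lq p (Yp p N) a b (a + ε * i) (b - δ * j)) :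
    False := by
  rcases hε with rfl | rfl <;> rcases hδ with rfl | rfl
  · rw [Lq_eq (x0 := a-1) (x1 := a) (y0 := b) (y1 := b + c) (by omega) (by omega) (by omega) (by omega)] at h1
    rw [Lq_eq (x0 := a) (x1 := a+i) (y0 := b-j) (y1 := b) (by omega) (by omega) (by omega) (by omega)] at h2
    refine H.hZ1 (a := a) (b := b) (k := c) (i := i) (j := j) (Rq_mem hM (by omega) (by omega))
      (by omega) (by omega) (by omega)
      (fun s t _ _ _ _ => Rq_mem h1.1 (by omega) (by omega))
      (fun s t _ _ _ _ => Rq_mem h2.1 (by omega) (by omega)) ?_ ?_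
    · by_contra hn
      have := h1.2.2 hn
      omega
    · by_contra hn
      have := h2.2.2 hn
      omega
  · rw [Lq_eq (x0 := a-1) (x1 := a) (y0 := b+c) (y1 := b) (by omega) (by omega) (by omega) (by omega)] at h1
    rw [Lq_eq (x0 := a) (x1 := a+i) (y0 := b) (y1 := b+j) (by omega) (by omega) (by omega) (by omega)] at h2
    have := H.hS1 (a := a) (b := b) (k := -c) (i := i) (j := j) (Rq_mem hM (by omega) (by omega))
      (by omega) (by omega) (by omega)
      (fun s t _ _ _ _ => Rq_mem h1.1 (by omega) (by omega))
      (fun s t _ _ _ _ => Rq_mem h2.1 (by omega) (by omega))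
    rw [sub_neg_eq_add] at this
    rcases this with h | h
    · exact h1.2.1 (by omega) h
    · exact h2.2.1 (by omega) h
  · rw [Lq_eq (x0 := a) (x1 := a+1) (y0 := b) (y1 := b+c) (by omega) (by omega) (by omega) (by omega)] at h1
    rw [Lq_eq (x0 := a-i) (x1 := a) (y0 := b-j) (y1 := b) (by omega) (by omega) (by omega) (by omega)] at h2
    have := H.hS2 (a := a) (b := b) (k := c) (i := i) (j := j) (Rq_mem hM (by omega) (by omega))
      (by omega) (by omega) (by omega)
      (fun s t _ _ _ _ => Rq_mem h1.1 (by omega) (by omega))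
      (fun s t _ _ _ _ => Rq_mem h2.1 (by omega) (by omega))
    rcases this with h | h
    · exact h1.2.1 (by omega) h
    · exact h2.2.1 (by omega) h
  · rw [Lq_eq (x0 := a) (x1 := a+1) (y0 := b+c) (y1 := b) (by omega) (by omega) (by omega) (by omega)] at h1
    rw [Lq_eq (x0 := a-i) (x1 := a) (y0 := b) (y1 := b+j) (by omega) (by omega) (by omega) (by omega)] at h2
    refine H.hZ2 (a := a) (b := b) (k := -c) (i := i) (j := j) (Rq_mem hM (by omega) (by omega))
      (by omega) (by omega) (by omega)
      (fun s t _ _ _ _ => Rq_mem h1.1 (by omega) (by omega))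
      (fun s t _ _ _ _ => Rq_mem h2.1 (by omega) (by omega)) ?_ ?_
    · by_contra hn
      rw [sub_neg_eq_add] at hn
      have := h1.2.2 hn
      omega
    · by_contra hn
      have := h2.2.2 hn
      omega

theorem Yp_t' : Yp (fun x y => p y x) (fun x y x' y' => N y x y' x') = fun x y => Yp p N y x := by
  funext X W; exact propext (Yp_t X W)

theorem PS.soft (H : PS p N) (a b ε δ : ℤ) (hε : Sg ε) (hδ : Sg δ)
    (h1 : Rq p a b (a + 2 * ε) (b + δ)) (h2 : Rq p a b (a + ε) (b + 2 * δ)) :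
    (∀ c, Rq p (a + ε) b c (b + δ) → Rq p a b c (b + δ) →
        (Lq p (Yp p N) a b c (b + δ) ↔ Lq p (Yp p N) (a + ε) b c (b + δ))) ∨
    (∀ d, Rq p a (b + δ) (a + ε) d → Rq p a b (a + ε) d →
        (Lq p (Yp p N) a b (a + ε) d ↔ Lq p (Yp p N) a (b + δ) (a + ε) d)) := by
  rcases hε with rfl | rfl <;> rcases hδ with rfl | rfl
  · have m0 : p a b := Rq_mem h1 (by omega) (by omega)
    have m1 : p (a+1) b := Rq_mem h1 (by omega) (by omega)
    have m2 : p a (b+1) := Rq_mem h2 (by omega) (by omega)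
    left
    intro c c1 c2
    refine softR (H.softz m0 (Or.inl rfl) m1 m2).1 ?_ (by omega) c1 c2
    exact fun m3 => H.deg m0 m1 m2 m3 (by unfold Ad; omega) (by unfold Ad; omega) (by unfold Ad; omega)
      (by omega) (by omega) (by omega)
  · have m0 : p a (b-1) := Rq_mem h1 (by omega) (by omega)
    have m1 : p (a+1) (b-1) := Rq_mem h1 (by omega) (by omega)
    have m2 : p a (b-1-1) := Rq_mem h2 (by omega) (by omega)
    have s : SC1 p a (b-1) := ⟨m0, m1, m2⟩
    have e := H.sc1 s
    rcases H.soft1 s with h | h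
    · left
      intro c c1 c2
      exact softR h e.1 (by omega) c1 c2
    · right
      intro d c1 c2
      have := softD (c := d) (x1 := a) (x2 := a+1) h e.2 (by omega)
        (by simpa [sub_eq_add_neg] using c1) (by simpa using c2)
      simpa [sub_eq_add_neg] using this
  · have m0 : p (a-1) b := Rq_mem h1 (by omega) (by omega)
    have m1 : p (a-1-1) b := Rq_mem h1 (by omega) (by omega)
    have m2 : p (a-1) (b+1) := Rq_mem h2 (by omega) (by omega)
    have s : SC2 p (a-1) b := ⟨m0, m1, m2⟩
    have e := H.sc2 s
    rcases H.soft2 s with h | h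
    · right
      intro c c1 c2
      exact softU h e.2 (by omega) c1 c2
    · left
      intro d c1 c2
      have := softL (c := d) (y1 := b) (y2 := b+1) h e.1 (by omega)
        (by simpa [sub_eq_add_neg] using c1) (by simpa using c2)
      simpa [sub_eq_add_neg] using this
  · have m0 : p (a-1) (b-1) := Rq_mem h1 (by omega) (by omega)
    have m1 : p (a-1+-1) (b-1) := Rq_mem h1 (by omega) (by omega)
    have m2 : p (a-1) (b-1+-1) := Rq_mem h2 (by omega) (by omega)
    left
    intro c c1 c2
    have := softL (c := c) (y1 := b) (y2 := b-1) (H.softz m0 (Or.inr rfl) m1 m2).2 ?_ (by omega)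
        (by simpa [sub_eq_add_neg] using c1) (by simpa [sub_eq_add_neg] using c2)
    · simpa [sub_eq_add_neg] using this
    · exact fun m3 => H.deg m0 m1 m2 m3 (by unfold Ad; omega) (by unfold Ad; omega) (by unfold Ad; omega)
        (by omega) (by omega) (by omega)

theorem PS.cfg (H : PS p N) : Cfg (Rq p) (Lq p (Yp p N)) where
  Rx _ _ _ _ := Rq_x
  Ry _ _ _ _ := Rq_y
  ne _ _ _ _ h := ⟨h.1, h.2.1⟩
  splitx x y x' y' x'' h h' := Rq_split h h'
  splity x y x' y' y'' h h' := by
    have := Rq_split (p := fun x y => p y x) (y := x) (y' := x') h h'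
    exact (Rq_t (p := p)).symm.trans (this.trans (and_congr (Rq_t (p := p)) (Rq_t (p := p))))
  no22 x y x' y' h := by
    by_contra hc
    have e1 := h.1
    have e2 := h.2.1
    have : ∀ s t, min x x' ≤ s → s ≤ min x x' + 1 → min y y' ≤ t → t ≤ min y y' + 1 → p s t :=
      fun s t _ _ _ _ => Rq_mem h (by omega) (by omega)
    exact H.no22 (this (min x x') (min y y') (by omega) (by omega) (by omega) (by omega))
      (this _ _ (by omega) (by omega) (by omega) (by omega))
      (this _ _ (by omega) (by omega) (by omega) (by omega))
      (this _ _ (by omega) (by omega) (by omega) (by omega))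
  diag x y ε δ hε hδ h1 h2 := by
    have key1 : p (x-1) (y-1) → p x y → p x (y-1) ∨ p (x-1) y := fun a b => by
      simpa using H.dg1 (x := x-1) (y := y-1) a (by simpa using b)
    have key2 : p (x-1) y → p x (y-1) → p x y ∨ p (x-1) (y-1) := fun a b => by
      simpa using H.dg2 (x := x-1) (y := y) a (by simpa using b)
    have one : ∀ ε' δ' s t, Sg ε' → Sg δ' → (2 * s = 2 * x + ε' - 1) → (2 * t = 2 * y + δ' - 1) → p s t →
        Rq p x y (x+ε') (y+δ') := by
      intro ε' δ' s t a b c d e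
      unfold Sg at a b
      refine Rq_of (by omega) (by omega) fun s' t' _ _ => ?_
      have e1 : s' = s := by omega
      have e2 : t' = t := by omega
      rw [e1, e2]; exact e
    rw [sub_eq_add_neg, sub_eq_add_neg]
    rcases hε with rfl | rfl <;> rcases hδ with rfl | rfl
    · rcases key1 (Rq_mem h2 (by omega) (by omega)) (Rq_mem h1 (by omega) (by omega)) with h | h
      · exact Or.inl (one 1 (-1) _ _ (by simp [Sg]) (by simp [Sg]) (by omega) (by omega) h)
      · exact Or.inr (one (-1) 1 _ _ (by simp [Sg]) (by simp [Sg]) (by omega) (by omega) h)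
    · rcases key2 (Rq_mem h2 (by omega) (by omega)) (Rq_mem h1 (by omega) (by omega)) with h | h
      · exact Or.inl (one 1 _ _ _ (by simp [Sg]) (by simp [Sg]) (by omega) (by omega) h)
      · exact Or.inr (one (-1) (-1) _ _ (by simp [Sg]) (by simp [Sg]) (by omega) (by omega) h)
    · rcases key2 (Rq_mem h1 (by omega) (by omega)) (Rq_mem h2 (by omega) (by omega)) with h | h
      · exact Or.inr (one _ 1 _ _ (by simp [Sg]) (by simp [Sg]) (by omega) (by omega) h)
      · exact Or.inl (one (-1) (-1) _ _ (by simp [Sg]) (by simp [Sg]) (by omega) (by omega) h)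
    · rcases key1 (Rq_mem h1 (by omega) (by omega)) (Rq_mem h2 (by omega) (by omega)) with h | h
      · exact Or.inr (one _ (-1) _ _ (by simp [Sg]) (by simp [Sg]) (by omega) (by omega) h)
      · exact Or.inl (one (-1) _ _ _ (by simp [Sg]) (by simp [Sg]) (by omega) (by omega) h)
  Lsym x y x' y' h := by
    have e1 := h.1.1
    have e2 := h.1.2.1
    refine ⟨Rq_x (Rq_y h.1), ?_⟩
    rw [min_comm x' x, max_comm x' x, min_comm y' y, max_comm y' y, ← h.2]
    omega
  LR x y x' y' h := h.1
  dich x y x' y' h := by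
    have e1 := h.1
    have e2 := h.2.1
    have h' := Rq_y h
    unfold Lq
    rw [min_comm y' y, max_comm y' y]
    simp only [h, h', true_and]
    have : (x < x' ↔ y' < y) ↔ ¬ (x < x' ↔ y < y') := by omega
    rw [this]
    tauto
  soft := H.soft
  hardh := H.hardh
  hardv a b ε δ c i j hε hδ hM hc hi hj h1 h2 := by
    refine H.transp.hardh b a δ ε c j i hδ hε (Rq_t.2 hM) hc hj hi ?_ ?_
    · rw [Yp_t', Lq_t]; exact h1
    · rw [Yp_t', Lq_t]; exact h2

end

theorem Ylt_asymm {Y : Set Pt} {a b : Pt} (h : Ylt Y a b) : ¬ Ylt Y b a := by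
  unfold Ylt lt1 at *
  rcases h with h | h | h
  · tauto
  · rintro (h' | h' | h')
    · tauto
    · omega
    · tauto
  · rintro (h' | h' | h')
    · tauto
    · tauto
    · omega

theorem Ylt_irr {Y : Set Pt} (a : Pt) : ¬ Ylt Y a a := fun h => Ylt_asymm h h

theorem lexLt_top {Y : Set Pt} {u u' v v' : Pt} (h1 : Ylt Y u' u) (h2 : Ylt Y v u)
    (h3 : Ylt Y v' u) :
    lexLt (Ylt Y) (Finsupp.single v 1 + Finsupp.single v' 1)
      (Finsupp.single u 1 + Finsupp.single u' 1) := by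
  have n : ∀ {z w : Pt}, Ylt Y z w → z ≠ w := by
    rintro z w h rfl; exact Ylt_irr _ h
  refine ⟨u, ?_, fun w hw => ?_⟩
  · simp [Finsupp.single_apply, n h2, n h3]
  · have n' : ∀ {z : Pt}, Ylt Y z u → z ≠ w := by
      rintro z h rfl; exact Ylt_asymm h hw
    simp [Finsupp.single_apply, n' h1, n' h2, n' h3, n hw]

theorem lead_core {Y : Set Pt} {x y x' y' : ℤ} (hx : x < x') (hy : y < y') :
    (¬ anti (fun s t => (s, t) ∈ Y) x y x' y' →
      lexLt (Ylt Y) (ee x y' + ee x' y) (ee x y + ee x' y')) ∧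
    (anti (fun s t => (s, t) ∈ Y) x y x' y' →
      lexLt (Ylt Y) (ee x y + ee x' y') (ee x y' + ee x' y)) := by
  unfold anti ee
  have lab : lt1 (x, y) (x', y') := Or.inl hx
  have lac : lt1 (x, y) (x, y') := Or.inr ⟨rfl, hy⟩
  have lad : lt1 (x, y) (x', y) := Or.inl hx
  have lcb : lt1 (x, y') (x', y') := Or.inl hx
  have ldb : lt1 (x', y) (x', y') := Or.inr ⟨rfl, hy⟩
  have lcd : lt1 (x, y') (x', y) := Or.inl hx
  by_cases hb : ((x', y') : Pt) ∈ Y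
  · refine ⟨fun _ => ?_, fun h => absurd hb h.1⟩
    rw [add_comm (Finsupp.single ((x, y) : Pt) 1)]
    apply lexLt_top <;> unfold Ylt <;> tauto
  · constructor
    · intro h
      by_cases ha : ((x, y) : Pt) ∈ Y
      · apply lexLt_top <;> unfold Ylt <;> tauto
      · rw [add_comm (Finsupp.single ((x, y) : Pt) 1)]
        apply lexLt_top <;> unfold Ylt <;> tauto
    · intro h
      by_cases hd : ((x', y) : Pt) ∈ Y
      · rw [add_comm (Finsupp.single ((x, y') : Pt) 1)]
        apply lexLt_top <;> unfold Ylt <;> tauto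
      · apply lexLt_top <;> unfold Ylt <;> tauto

theorem mem_VP {P : Finset Pt} {s t x y : ℤ} (h : (s, t) ∈ P) (hx : x = s ∨ x = s + 1)
    (hy : y = t ∨ y = t + 1) : (x, y) ∈ VP P := by
  unfold VP
  simp only [Set.mem_iUnion]
  refine ⟨(s, t), h, ?_⟩
  unfold cellVerts
  rcases hx with rfl | rfl <;> rcases hy with rfl | rfl <;> simp

theorem PathS.gdata {P : Finset Pt} {nx : Pt → Pt → Prop} (H : PathS P nx) :
    ∃ Y : Set Pt, Y ⊆ VP P ∧ ∃ L, GData P Y L := by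
  have H' := H.toPS
  have D := H'.cfg
  set p : ℤ → ℤ → Prop := fun x y => (x, y) ∈ P with hp
  set N : ℤ → ℤ → ℤ → ℤ → Prop := fun x y x' y' => nx (x, y) (x', y') with hN
  refine ⟨{w | Yp p N w.1 w.2}, ?_, Lq p (Yp p N), ?_⟩
  · rintro ⟨X, W⟩ ⟨x, y, h | h | h⟩
    · exact mem_VP h.1.1 (Or.inl h.2.2.1) (Or.inr h.2.2.2)
    · exact mem_VP h.1.1 (Or.inr h.2.2.1) (Or.inl h.2.2.2)
    · have m : (x, y) ∈ P := by
        rcases h.1.1 with h | h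
        · exact h.1
        · exact h.1
      rcases h.2 with h | h
      · exact mem_VP m (Or.inr h.2.1) (Or.inr h.2.2)
      · exact mem_VP m (Or.inl h.2.1) (Or.inl h.2.2)
  · refine ⟨D.Lsym, ?_, fun x y x' y' h => ⟨h.1.1, h.1.2.1⟩, ?_, ?_, ?_, D.loc⟩
    · intro x y x' y' h
      have e1 := h.1.1
      have e2 := h.1.2.1
      have : ∀ s t, ((x ≤ s ∧ s < x') ∨ (x' ≤ s ∧ s < x)) →
        ((y ≤ t ∧ t < y') ∨ (y' ≤ t ∧ t < y)) → (s, t) ∈ P := fun s t a b => Rq_mem h.1 a b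
      rcases lt_or_gt_of_ne e1 with hx | hx <;> rcases lt_or_gt_of_ne e2 with hy | hy
      · exact mem_VP (this x y (by omega) (by omega)) (by omega) (by omega)
      · exact mem_VP (this x (y-1) (by omega) (by omega)) (by omega) (by omega)
      · exact mem_VP (this (x-1) y (by omega) (by omega)) (by omega) (by omega)
      · exact mem_VP (this (x-1) (y-1) (by omega) (by omega)) (by omega) (by omega)
    · rintro ⟨a, b⟩ ⟨a', b'⟩ ⟨h1, h2, h3⟩
      exact D.two ((Rq_lt h1 h2).2 fun s t i j k l => h3 (s, t) i j k l)
    · intro x y x' y' h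
      have e1 := h.1.1
      have e2 := h.1.2.1
      exact ⟨by show min x x' < max x x'; omega, by show min y y' < max y y'; omega,
        fun c i j k l => h.1.2.2 c.1 c.2 i j k l⟩
    · intro x y x' y' h
      have e1 := h.1.1
      have e2 := h.1.2.1
      have q := h.2
      have core := fun (x y x' y' : ℤ) => lead_core (Y := {w : Pt | Yp p N w.1 w.2})
        (x := x) (y := y) (x' := x') (y' := y')
      rcases lt_or_gt_of_ne e1 with hx | hx <;> rcases lt_or_gt_of_ne e2 with hy | hy
      · rw [min_eq_left hx.le, min_eq_left hy.le, max_eq_right hx.le, max_eq_right hy.le] at q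
        exact (core x y x' y' hx hy).1 (q.1 (by omega))
      · rw [min_eq_left hx.le, min_eq_right hy.le, max_eq_right hx.le, max_eq_left hy.le] at q
        refine (core x y' x' y hx hy).2 ?_
        by_contra hn
        have := q.2 hn
        omega
      · rw [min_eq_right hx.le, min_eq_left hy.le, max_eq_left hx.le, max_eq_right hy.le] at q
        have := (core x' y x y' hx hy).2 (by
          by_contra hn
          have := q.2 hn
          omega)
        rw [add_comm (ee x y'), add_comm (ee x y)]
        exact this
      · rw [min_eq_right hx.le, min_eq_right hy.le, max_eq_left hx.le, max_eq_left hy.le] at q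
        have := (core x' y' x y hx hy).1 (q.1 (by omega))
        rw [add_comm (ee x y'), add_comm (ee x y)]
        exact this

theorem exists_Y_reducedGB_and_squarefree_initialIdeal
    (K : Type*) [Field K] (P : Finset Pt) (hP : IsClosedPath P) :
    ∃ Y : Set Pt, Y ⊆ VP P ∧
      IsReducedGroebnerBasis (Ylt Y) (minorsSet K P) (polyoIdeal K P) ∧
      ∃ M : Set (Pt →₀ ℕ), (∀ m ∈ M, ∀ w, m w ≤ 1) ∧
        initialIdeal (Ylt Y) (polyoIdeal K P) =
          Ideal.span ((fun m => (MvPolynomial.monomial m (1 : K))) '' M) := by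
  obtain ⟨nx, H⟩ := exists_pathS hP
  obtain ⟨Y, hY, L, D⟩ := H.gdata
  exact ⟨Y, hY, D.final K⟩

end ClosedPathPaper
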